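/- arXiv:2410.18651 — 3 statements merged into one kernel-verified Lean document; each statement's English description precedes it below -/
import Mathlib

section
/- For every a > 0 and b > 0, the transform R_{a,b} : C(-1,1) → C(-1,1) is injective: if R_{a,b} f = 0 for a continuous function f on (-1,1), then f = 0. -/
/-- The transform `R_{a,b}`, defined by `(R_{a,b} f)(t) = ∫₀¹ f(st) s^{a-1} (1-s²)^{b-1} ds`. -/
noncomputable def Rab (a b : ℝ) (f : ℝ → ℝ) (t : ℝ) : ℝ :=
  ∫ s in (0 : ℝ)..1, f (s * t) * s ^ (a - 1) * (1 - s ^ 2) ^ (b - 1)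

open MeasureTheory Set

lemma aux_rpow_int (r : ℝ) (hr : -1 < r) : IntegrableOn (fun y : ℝ => y ^ r) (Ioo 0 1) := by
  have := intervalIntegral.intervalIntegrable_rpow' (a := 0) (b := 1) hr
  rwa [intervalIntegrable_iff_integrableOn_Ioo_of_le zero_le_one] at this

lemma aux_mul_cont {F h : ℝ → ℝ} (hF : IntegrableOn F (Ioo 0 1))
    (hh : ContinuousOn h (Icc 0 1)) : IntegrableOn (fun y => F y * h y) (Ioo 0 1) := by
  have h1 : IntegrableOn F (Icc 0 1) := by rwa [integrableOn_Icc_iff_integrableOn_Ioo]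
  exact (h1.mul_continuousOn hh isCompact_Icc).mono_set Ioo_subset_Icc_self

lemma aux_dense {F : ℝ → ℝ} (hF : IntegrableOn F (Ioo 0 1))
    (hm : ∀ n : ℕ, ∫ y in Ioo (0:ℝ) 1, F y * (1 - y) ^ n = 0)
    {h : ℝ → ℝ} (hh : ContinuousOn h (Icc 0 1)) : ∫ y in Ioo (0:ℝ) 1, F y * h y = 0 := by
  have hpoly : ∀ p : Polynomial ℝ, ∫ y in Ioo (0:ℝ) 1, F y * p.eval (1 - y) = 0 := by
    intro p
    have : ∀ y, F y * p.eval (1 - y) = ∑ i ∈ Finset.range (p.natDegree + 1),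
        p.coeff i * (F y * (1 - y) ^ i) := by
      intro y
      rw [Polynomial.eval_eq_sum_range, Finset.mul_sum]
      exact Finset.sum_congr rfl fun i _ => by ring
    simp_rw [this]
    rw [integral_finsetSum]
    · refine Finset.sum_eq_zero fun i _ => ?_
      rw [integral_const_mul, hm, mul_zero]
    · intro i _
      exact (aux_mul_cont hF (by fun_prop)).const_mul _
  set M := ∫ y in Ioo (0:ℝ) 1, |F y| with hM
  have hM0 : 0 ≤ M := integral_nonneg fun _ => abs_nonneg _
  have key : ∀ ε > 0, |∫ y in Ioo (0:ℝ) 1, F y * h y| ≤ ε * M := by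
    intro ε hε
    have hc : ContinuousOn (fun x => h (1 - x)) (Icc 0 1) := by
      refine hh.comp (by fun_prop) ?_
      intro x hx
      exact ⟨by linarith [hx.2], by linarith [hx.1]⟩
    obtain ⟨p, hp⟩ := exists_polynomial_near_of_continuousOn 0 1 _ hc ε hε
    have e1 : ∫ y in Ioo (0:ℝ) 1, F y * h y
        = ∫ y in Ioo (0:ℝ) 1, (F y * h y - F y * p.eval (1 - y)) := by
      rw [integral_sub (aux_mul_cont hF hh), hpoly, sub_zero]
      exact aux_mul_cont hF (by fun_prop)
    rw [e1, hM, ← integral_const_mul, ← Real.norm_eq_abs]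
    refine norm_integral_le_of_norm_le (hF.abs.const_mul ε) ?_
    refine (ae_restrict_iff' measurableSet_Ioo).2 (Filter.Eventually.of_forall fun y hy => ?_)
    have := hp (1 - y) ⟨by linarith [hy.2], by linarith [hy.1]⟩
    rw [sub_sub_cancel] at this
    rw [← mul_sub, Real.norm_eq_abs, abs_mul, abs_sub_comm, mul_comm]
    exact mul_le_mul_of_nonneg_right this.le (abs_nonneg _)
  by_contra hne
  have hpos : 0 < |∫ y in Ioo (0:ℝ) 1, F y * h y| := abs_pos.2 hne
  have := key (|∫ y in Ioo (0:ℝ) 1, F y * h y| / (2 * (M + 1))) (by positivity)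
  rw [div_mul_eq_mul_div, le_div_iff₀ (by positivity)] at this
  nlinarith

lemma aux_abel (a b : ℝ) (g : ℝ → ℝ)
    (hR : ∀ t ∈ Ioo (0:ℝ) 1, Rab a b g t = 0) (x : ℝ) (hx : x ∈ Ioo (0:ℝ) 1) :
    ∫ y in Ioo (0:ℝ) x, g (√y) * y ^ (a/2-1) * (x-y) ^ (b-1) = 0 := by
  have hx0 := hx.1
  have him : (fun s : ℝ => s ^ 2 * x) '' Ioo 0 1 = Ioo 0 x := by
    ext y
    constructor
    · rintro ⟨s, hs, rfl⟩
      have := hs.1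
      have h2 : s ^ 2 < 1 := by nlinarith [hs.2]
      exact ⟨by positivity, by simp only; nlinarith⟩
    · intro hy
      have hq : 0 < y / x := div_pos hy.1 hx0
      refine ⟨√(y / x), ⟨Real.sqrt_pos.2 hq, ?_⟩, ?_⟩
      · rw [Real.sqrt_lt' one_pos, one_pow, div_lt_one hx0]; exact hy.2
      · simp only
        rw [Real.sq_sqrt hq.le]; field_simp
  have hinj : InjOn (fun s : ℝ => s ^ 2 * x) (Ioo 0 1) := by
    intro s hs t ht hst
    have : s ^ 2 = t ^ 2 := mul_right_cancel₀ hx0.ne' hst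
    exact (pow_left_inj₀ hs.1.le ht.1.le two_ne_zero).1 this
  have hder : ∀ s ∈ Ioo (0:ℝ) 1,
      HasDerivWithinAt (fun s : ℝ => s ^ 2 * x) (2 * s * x) (Ioo 0 1) s := by
    intro s _
    have := ((hasDerivAt_pow 2 s).mul_const x).hasDerivWithinAt (s := Ioo 0 1)
    simpa using this
  rw [← him, integral_image_eq_integral_abs_deriv_smul measurableSet_Ioo hder hinj]
  have hRx := hR (√x) ⟨Real.sqrt_pos.2 hx0, by
    rw [Real.sqrt_lt' one_pos, one_pow]; exact hx.2⟩
  unfold Rab at hRx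
  rw [intervalIntegral.integral_of_le zero_le_one, integral_Ioc_eq_integral_Ioo] at hRx
  have : ∫ s in Ioo (0:ℝ) 1, |2 * s * x| • (g (√(s^2*x)) * (s^2*x) ^ (a/2-1) * (x-s^2*x) ^ (b-1))
      = ∫ s in Ioo (0:ℝ) 1, (2 * x * x ^ (a/2-1) * x ^ (b-1)) *
        (g (s * √x) * s ^ (a - 1) * (1 - s ^ 2) ^ (b - 1)) := by
    refine setIntegral_congr_fun measurableSet_Ioo fun s hs => ?_
    have hs0 := hs.1
    have h2 : s ^ 2 < 1 := by nlinarith [hs.2]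
    have e1 : √(s^2*x) = s * √x := by
      rw [Real.sqrt_mul (by positivity), Real.sqrt_sq hs0.le]
    have e2 : (s^2*x) ^ (a/2-1) = s ^ (a - 1) / s * x ^ (a/2-1) := by
      rw [Real.mul_rpow (by positivity) hx0.le, ← Real.rpow_natCast s 2, ← Real.rpow_mul hs0.le,
        ← Real.rpow_sub_one hs0.ne']
      congr 2
      push_cast; ring
    have e3 : (x-s^2*x) ^ (b-1) = x ^ (b-1) * (1 - s ^ 2) ^ (b - 1) := by
      rw [← Real.mul_rpow hx0.le (by linarith)]; congr 1; ring
    simp only [smul_eq_mul]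
    rw [e1, e2, e3, abs_of_pos (by positivity)]
    field_simp
  rw [this, integral_const_mul, hRx, mul_zero]

lemma aux_beta (b : ℝ) (n : ℕ) (y : ℝ) (hy : y ∈ Ioo (0:ℝ) 1) :
    ∫ x in Ioo y 1, (1 - x) ^ n * (x - y) ^ (b-1)
      = (∫ v in Ioo (0:ℝ) 1, v ^ (b-1) * (1 - v) ^ n) * ((1-y)^b * (1-y)^n) := by
  have h1 : 0 < 1 - y := by linarith [hy.2]
  have him : (fun v : ℝ => y + (1 - y) * v) '' Ioo 0 1 = Ioo y 1 := by
    ext x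
    constructor
    · rintro ⟨v, hv, rfl⟩
      have := hv.1
      have := hv.2
      exact ⟨by simp only; nlinarith, by simp only; nlinarith⟩
    · intro hx
      refine ⟨(x - y) / (1 - y), ⟨div_pos (by linarith [hx.1]) h1, ?_⟩, ?_⟩
      · rw [div_lt_one h1]; linarith [hx.2]
      · simp only
        field_simp; ring
  have hinj : InjOn (fun v : ℝ => y + (1 - y) * v) (Ioo 0 1) := by
    intro s _ t _ hst
    exact mul_left_cancel₀ h1.ne' (add_left_cancel hst)
  have hder : ∀ s ∈ Ioo (0:ℝ) 1,
      HasDerivWithinAt (fun v : ℝ => y + (1 - y) * v) (1 - y) (Ioo 0 1) s := by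
    intro s _
    have := (((hasDerivAt_id s).const_mul (1 - y)).const_add y).hasDerivWithinAt (s := Ioo 0 1)
    simpa using this
  rw [← him, integral_image_eq_integral_abs_deriv_smul measurableSet_Ioo hder hinj,
    ← integral_mul_const]
  refine setIntegral_congr_fun measurableSet_Ioo fun v hv => ?_
  simp only [smul_eq_mul]
  have e1 : (y + (1 - y) * v - y) ^ (b-1) = (1-y)^b / (1 - y) * v ^ (b-1) := by
    rw [← Real.rpow_sub_one h1.ne', ← Real.mul_rpow h1.le hv.1.le]; congr 1; ring
  have e2 : 1 - (y + (1 - y) * v) = (1 - y) * (1 - v) := by ring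
  rw [e1, e2, abs_of_pos h1, mul_pow]
  field_simp

lemma aux_moment (a b : ℝ) (ha : 0 < a) (hb : 0 < b) (g : ℝ → ℝ) (hg : Continuous g)
    (hR : ∀ t ∈ Ioo (0:ℝ) 1, Rab a b g t = 0) (n : ℕ) :
    ∫ y in Ioo (0:ℝ) 1, (y ^ (a/2-1) * (g (√y) * (1-y)^b)) * (1 - y) ^ n = 0 := by
  set ψ : ℝ → ℝ := (Ioo 0 1).indicator (fun y => y ^ (a/2-1) * g (√y)) with hψ
  set k : ℝ → ℝ := (Ioo 0 1).indicator (fun z => z ^ (b-1)) with hk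
  set w : ℝ → ℝ := (Ioo 0 1).indicator (fun x => (1 - x) ^ n) with hw
  set C := ∫ v in Ioo (0:ℝ) 1, v ^ (b-1) * (1 - v) ^ n with hC
  have hCpos : 0 < C := by
    rw [hC, ← integral_Ioc_eq_integral_Ioo, ← intervalIntegral.integral_of_le zero_le_one]
    refine intervalIntegral.intervalIntegral_pos_of_pos_on ?_ ?_ one_pos
    · rw [intervalIntegrable_iff_integrableOn_Ioo_of_le zero_le_one]
      exact aux_mul_cont (aux_rpow_int _ (by linarith)) (by fun_prop)
    · intro x hx
      have := hx.1
      have : 0 < 1 - x := by linarith [hx.2]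
      positivity
  have hψi : Integrable ψ := by
    rw [hψ, integrable_indicator_iff measurableSet_Ioo]
    exact aux_mul_cont (aux_rpow_int _ (by linarith)) (by fun_prop)
  have hki : Integrable k := by
    rw [hk, integrable_indicator_iff measurableSet_Ioo]
    exact aux_rpow_int _ (by linarith)
  have hwm : Measurable w := Measurable.indicator (by fun_prop) measurableSet_Ioo
  have hwb : ∀ x, ‖w x‖ ≤ 1 := by
    intro x
    by_cases hx : x ∈ Ioo (0:ℝ) 1
    · rw [hw, indicator_of_mem hx, norm_pow]
      refine pow_le_one₀ (norm_nonneg _) ?_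
      rw [Real.norm_eq_abs, abs_le]
      constructor <;> linarith [hx.1, hx.2]
    · rw [hw, indicator_of_notMem hx]; simp
  have hint : Integrable (Function.uncurry fun x y => w x * (ψ y * k (x - y)))
      ((volume : Measure ℝ).prod (volume : Measure ℝ)) := by
    have := Integrable.convolution_integrand (ContinuousLinearMap.mul ℝ ℝ) (μ := volume)
      (ν := volume) hψi hki
    exact this.bdd_mul (hwm.comp measurable_fst).aestronglyMeasurable
      (Filter.Eventually.of_forall fun p => hwb p.1)
  have hswap := integral_integral_swap hint
  have hL : ∀ x, ∫ y, w x * (ψ y * k (x - y)) = 0 := by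
    intro x
    rw [integral_const_mul]
    by_cases hx : x ∈ Ioo (0:ℝ) 1
    · have : ∀ y, ψ y * k (x - y) = (Ioo 0 x).indicator
          (fun y => g (√y) * y ^ (a/2-1) * (x-y) ^ (b-1)) y := by
        intro y
        by_cases hy : y ∈ Ioo 0 x
        · rw [indicator_of_mem hy, hψ, hk, indicator_of_mem (show y ∈ Ioo (0:ℝ) 1 from
            ⟨hy.1, hy.2.trans hx.2⟩), indicator_of_mem (show x - y ∈ Ioo (0:ℝ) 1 from
            ⟨by linarith [hy.2], by linarith [hy.1, hx.2]⟩)]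
          ring
        · rw [indicator_of_notMem hy]
          by_cases hy1 : y ∈ Ioo (0:ℝ) 1
          · have : x - y ∉ Ioo (0:ℝ) 1 := fun h => hy ⟨hy1.1, by linarith [h.1]⟩
            rw [hk, indicator_of_notMem this, mul_zero]
          · rw [hψ, indicator_of_notMem hy1, zero_mul]
      simp_rw [this]
      rw [integral_indicator measurableSet_Ioo, aux_abel a b g hR x hx, mul_zero]
    · rw [hw, indicator_of_notMem hx, zero_mul]
  have hRr : ∀ y, ∫ x, w x * (ψ y * k (x - y)) = C * (Ioo 0 1).indicator
      (fun y => (y ^ (a/2-1) * (g (√y) * (1-y)^b)) * (1 - y) ^ n) y := by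
    intro y
    by_cases hy : y ∈ Ioo (0:ℝ) 1
    · have : ∀ x, w x * (ψ y * k (x - y)) = ψ y * (Ioo y 1).indicator
          (fun x => (1 - x) ^ n * (x - y) ^ (b-1)) x := by
        intro x
        by_cases hx : x ∈ Ioo y 1
        · rw [indicator_of_mem hx, hw, hk, indicator_of_mem (show x ∈ Ioo (0:ℝ) 1 from
            ⟨hy.1.trans hx.1, hx.2⟩), indicator_of_mem (show x - y ∈ Ioo (0:ℝ) 1 from
            ⟨by linarith [hx.1], by linarith [hy.1, hx.2]⟩)]
          ring
        · rw [indicator_of_notMem hx]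
          by_cases hx1 : x ∈ Ioo (0:ℝ) 1
          · have : x - y ∉ Ioo (0:ℝ) 1 := fun h => hx ⟨by linarith [h.1], hx1.2⟩
            rw [hk, indicator_of_notMem this]; ring
          · rw [hw, indicator_of_notMem hx1]; ring
      simp_rw [this]
      rw [integral_const_mul, integral_indicator measurableSet_Ioo, aux_beta b n y hy,
        indicator_of_mem hy, hψ, indicator_of_mem hy]
      ring
    · rw [hψ, indicator_of_notMem hy, indicator_of_notMem hy]; simp
  simp_rw [hL, hRr] at hswap
  rw [integral_const_mul, integral_indicator measurableSet_Ioo] at hswap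
  simpa [hCpos.ne'] using hswap.symm

lemma aux_main (a b : ℝ) (ha : 0 < a) (hb : 0 < b) (g : ℝ → ℝ) (hg : Continuous g)
    (hR : ∀ t ∈ Ioo (0:ℝ) 1, Rab a b g t = 0) : g 1 = 0 := by
  have hb' : Continuous fun y : ℝ => (1 - y) ^ b :=
    (continuous_const.sub continuous_id).rpow_const fun _ => Or.inr hb.le
  have hF : IntegrableOn (fun y : ℝ => y ^ (a/2-1) * (g (√y) * (1-y)^b)) (Ioo 0 1) :=
    aux_mul_cont (aux_rpow_int _ (by linarith)) (by fun_prop)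
  have h1 := aux_dense hF (aux_moment a b ha hb g hg hR) (h := fun y => g (√y) * y)
    (by fun_prop)
  have ha' : Continuous fun y : ℝ => y ^ (a/2) :=
    continuous_id.rpow_const fun _ => Or.inr (by positivity)
  have h2 : ∫ y in (0:ℝ)..1, y ^ (a/2) * (1-y)^b * g (√y) ^ 2 = 0 := by
    rw [intervalIntegral.integral_of_le zero_le_one, integral_Ioc_eq_integral_Ioo]
    refine Eq.trans ?_ h1
    refine setIntegral_congr_fun measurableSet_Ioo fun y hy => ?_
    have := hy.1
    rw [Real.rpow_sub_one hy.1.ne']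
    field_simp
  have h3 : ∀ y ∈ Ioo (0:ℝ) 1, g (√y) = 0 := by
    intro y hy
    by_contra hne
    have hy0 := hy.1
    have hy1 : 0 < 1 - y := by linarith [hy.2]
    have := intervalIntegral.integral_pos (f := fun y : ℝ => y ^ (a/2) * (1-y)^b * g (√y) ^ 2)
      one_pos (by fun_prop) (fun x hx => by
        have := hx.1.le
        have : 0 ≤ 1 - x := by linarith [hx.2]
        positivity) ⟨y, Ioo_subset_Icc_self hy, by positivity⟩
    exact this.ne' h2
  have h4 : EqOn (fun y => g (√y)) 0 (closure (Ioo 0 1)) :=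
    EqOn.closure (fun y hy => h3 y hy) (by fun_prop) continuous_const
  have := h4 (x := 1) (by rw [closure_Ioo zero_ne_one]; simp)
  simpa using this

/-- For `a, b > 0`, the transform `R_{a,b} : C(-1,1) → C(-1,1)` is injective. -/
theorem stmt_3 (a b : ℝ) (ha : 0 < a) (hb : 0 < b) (f : ℝ → ℝ)
    (hf : ContinuousOn f (Set.Ioo (-1) 1))
    (h0 : ∀ t ∈ Set.Ioo (-1 : ℝ) 1, Rab a b f t = 0) :
    ∀ t ∈ Set.Ioo (-1 : ℝ) 1, f t = 0 := by
  intro t ht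
  have hmem : ∀ u ∈ Icc (0:ℝ) 1, u * t ∈ Ioo (-1 : ℝ) 1 := by
    intro u hu
    have h1 := hu.1
    have h2 := hu.2
    have h3 := ht.1
    have h4 := ht.2
    constructor <;> nlinarith
  have hcl : ∀ u : ℝ, max 0 (min 1 u) ∈ Icc (0:ℝ) 1 := fun u =>
    ⟨le_max_left _ _, max_le zero_le_one (min_le_left _ _)⟩
  have hid : ∀ u ∈ Icc (0:ℝ) 1, max 0 (min 1 u) = u := fun u hu => by
    rw [min_eq_right hu.2, max_eq_right hu.1]
  have hg : Continuous fun u : ℝ => f (max 0 (min 1 u) * t) :=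
    hf.comp_continuous (by fun_prop) fun u => hmem _ (hcl u)
  have := aux_main a b ha hb _ hg (fun r hr => by
    refine Eq.trans ?_ (h0 (r * t) (hmem r (Ioo_subset_Icc_self hr)))
    unfold Rab
    refine intervalIntegral.integral_congr fun s hs => ?_
    rw [uIcc_of_le zero_le_one] at hs
    simp only
    rw [hid (s * r) ⟨mul_nonneg hs.1 hr.1.le, mul_le_one₀ hs.2 hr.1.le hr.2.le⟩, mul_assoc s r t])
  simpa using this
end

section
/- Let f : S^{n-1} → ℝ be zonal, i.e. f(u) = f̄(⟨eₙ, u⟩) for some f̄ : [-1,1] → ℝ. Then f is C^∞ on the sphere S^{n-1} if and only if f̄ belongs to C^∞[-1,1], i.e. f̄ is continuous on [-1,1], infinitely differentiable on (-1,1), and all higher-order one-sided derivatives exist at ±1. -/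
open RealInnerProductSpace
open scoped Manifold

instance stmt12Fact (n : ℕ) :
    Fact (Module.finrank ℝ (EuclideanSpace ℝ (Fin (n + 1))) = n + 1) :=
  ⟨finrank_euclideanSpace_fin⟩

open Set Filter Topology MeasureTheory in
/-- Differentiation under the integral sign for the Hadamard quotient. -/
theorem hadamard_hasDerivAt (p : ℕ) (h : ℝ → ℝ) (hh : ContDiff ℝ (⊤ : ℕ∞) h) (t : ℝ) :
    HasDerivAt (fun t : ℝ => ∫ s in (0:ℝ)..1, s ^ p * h (t * s))
      (∫ s in (0:ℝ)..1, s ^ (p + 1) * deriv h (t * s)) t := by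
  have hc : Continuous h := hh.continuous
  have hd : Differentiable ℝ h := hh.differentiable (by simp)
  have hc' : Continuous (deriv h) := hh.continuous_deriv (by simp)
  obtain ⟨C, hC⟩ := (isCompact_Icc (a := -(|t| + 1)) (b := |t| + 1)).exists_bound_of_continuousOn
    hc'.continuousOn
  refine (intervalIntegral.hasDerivAt_integral_of_dominated_loc_of_deriv_le
    (F := fun t s => s ^ p * h (t * s)) (F' := fun t s => s ^ (p + 1) * deriv h (t * s))
    (bound := fun _ => C) (s := Metric.ball t 1) (Metric.ball_mem_nhds t one_pos)
    ?_ ?_ ?_ ?_ ?_ ?_).2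
  · refine Eventually.of_forall fun x => Continuous.aestronglyMeasurable ?_
    fun_prop
  · refine Continuous.intervalIntegrable ?_ _ _
    fun_prop
  · refine Continuous.aestronglyMeasurable ?_
    fun_prop
  · refine Eventually.of_forall fun s hs x hx => ?_
    rw [uIoc_of_le zero_le_one] at hs
    have h1 : |x| ≤ |t| + 1 := by
      have : |x - t| < 1 := by simpa [Real.dist_eq] using hx
      have := abs_sub_abs_le_abs_sub x t
      linarith
    have h2 : |x * s| ≤ |t| + 1 := by
      rw [abs_mul, abs_of_pos hs.1]
      nlinarith [abs_nonneg x, hs.1, hs.2]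
    have h3 := hC (x * s) (abs_le.1 h2)
    rw [norm_mul, norm_pow, Real.norm_eq_abs, abs_of_pos hs.1]
    have h4 : s ^ (p + 1) ≤ 1 := pow_le_one₀ hs.1.le hs.2
    have h5 : 0 ≤ s ^ (p + 1) := pow_nonneg hs.1.le _
    nlinarith [norm_nonneg (deriv h (x * s))]
  · exact intervalIntegrable_const
  · refine Eventually.of_forall fun s _ x _ => ?_
    have h1 : HasDerivAt (fun x : ℝ => x * s) s x := by
      simpa using (hasDerivAt_id x).mul_const s
    have h2 := ((hd (x * s)).hasDerivAt.comp x h1).const_mul (s ^ p)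
    have h3 : s ^ (p + 1) * deriv h (x * s) = s ^ p * (deriv h (x * s) * s) := by ring
    rw [h3]
    exact h2

theorem hadamard_contDiff_nat (m : ℕ) : ∀ (p : ℕ) (h : ℝ → ℝ), ContDiff ℝ (⊤ : ℕ∞) h →
    ContDiff ℝ m (fun t : ℝ => ∫ s in (0:ℝ)..1, s ^ p * h (t * s)) := by
  induction m with
  | zero =>
    intro p h hh
    have : Differentiable ℝ (fun t : ℝ => ∫ s in (0:ℝ)..1, s ^ p * h (t * s)) :=
      fun t => (hadamard_hasDerivAt p h hh t).differentiableAt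
    exact contDiff_zero.2 this.continuous
  | succ m ih =>
    intro p h hh
    have hd : ContDiff ℝ (⊤ : ℕ∞) (deriv h) := (contDiff_infty_iff_deriv.1 hh).2
    push_cast
    rw [contDiff_succ_iff_deriv]
    refine ⟨fun t => (hadamard_hasDerivAt p h hh t).differentiableAt, by simp, ?_⟩
    rw [show deriv (fun t : ℝ => ∫ s in (0:ℝ)..1, s ^ p * h (t * s)) = _ from
      funext fun t => (hadamard_hasDerivAt p h hh t).deriv]
    exact ih (p + 1) _ hd

/-- Hadamard's lemma in one variable, centred at `a`. -/
theorem hadamard_exists (h : ℝ → ℝ) (hh : ContDiff ℝ (⊤ : ℕ∞) h) (a : ℝ) (ha : h a = 0) :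
    ∃ k : ℝ → ℝ, ContDiff ℝ (⊤ : ℕ∞) k ∧ (∀ t, h t = (t - a) * k t) ∧ k a = deriv h a := by
  have hd : Differentiable ℝ h := hh.differentiable (by simp)
  let h₁ : ℝ → ℝ := fun t => deriv h (a + t)
  have hh₁ : ContDiff ℝ (⊤ : ℕ∞) h₁ := by
    have hd : ContDiff ℝ (⊤ : ℕ∞) (deriv h) := (contDiff_infty_iff_deriv.1 hh).2
    exact hd.comp (contDiff_const.add contDiff_id)
  have hK : ContDiff ℝ (⊤ : ℕ∞) (fun t : ℝ => ∫ s in (0:ℝ)..1, s ^ 0 * h₁ (t * s)) :=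
    contDiff_infty.2 fun m => hadamard_contDiff_nat m 0 h₁ hh₁
  refine ⟨fun t => ∫ s in (0:ℝ)..1, s ^ 0 * h₁ ((t - a) * s),
    hK.comp (contDiff_id.sub contDiff_const), fun t => ?_, by simp [h₁]⟩
  have hc : Continuous h₁ := hh₁.continuous
  have key : ∫ s in (0:ℝ)..1, (t - a) * h₁ ((t - a) * s) =
      h (a + (t - a) * 1) - h (a + (t - a) * 0) := by
    refine intervalIntegral.integral_eq_sub_of_hasDerivAt
      (f := fun s => h (a + (t - a) * s)) (fun s _ => ?_) ?_
    · have h1 : HasDerivAt (fun s : ℝ => a + (t - a) * s) (t - a) s := by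
        simpa using ((hasDerivAt_id s).const_mul (t - a)).const_add a
      have h2 := (hd (a + (t - a) * s)).hasDerivAt.comp s h1
      rw [mul_comm]
      exact h2
    · refine Continuous.intervalIntegrable ?_ _ _
      fun_prop
  rw [intervalIntegral.integral_const_mul] at key
  simp only [pow_zero, one_mul]
  rw [key]
  simp [ha]

open Classical in
/-- Smooth division. -/
theorem smooth_div (h s : ℝ → ℝ) (hh : ContDiff ℝ (⊤ : ℕ∞) h) (hs : ContDiff ℝ (⊤ : ℕ∞) s)
    (h0 : ∀ t, s t = 0 → h t = 0) (h1 : ∀ t, s t = 0 → deriv s t ≠ 0) :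
    ContDiff ℝ (⊤ : ℕ∞) (fun t => if s t = 0 then deriv h t / deriv s t else h t / s t) := by
  rw [contDiff_iff_contDiffAt]
  intro a
  by_cases ha : s a = 0
  · obtain ⟨k₁, hk₁, e₁, v₁⟩ := hadamard_exists h hh a (h0 a ha)
    obtain ⟨k₂, hk₂, e₂, v₂⟩ := hadamard_exists s hs a ha
    have hne : k₂ a ≠ 0 := by rw [v₂]; exact h1 a ha
    refine (hk₁.contDiffAt.div hk₂.contDiffAt hne).congr_of_eventuallyEq ?_
    filter_upwards [hk₂.continuous.continuousAt.eventually_ne hne] with t ht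
    by_cases hta : t = a
    · subst hta
      simp [ha, v₁, v₂]
    · have : t - a ≠ 0 := sub_ne_zero.2 hta
      have hst : s t ≠ 0 := by rw [e₂]; exact mul_ne_zero this ht
      simp only [hst, if_false]
      rw [e₁, e₂, mul_div_mul_left _ _ this]
      rfl
  · refine (hh.contDiffAt.div hs.contDiffAt ha).congr_of_eventuallyEq ?_
    filter_upwards [hs.continuous.continuousAt.eventually_ne ha] with t ht
    simp [ht]

open Set Filter Topology in
theorem contDiffOn_of_comp_cos (m : ℕ) : ∀ F : ℝ → ℝ,
    ContDiff ℝ (⊤ : ℕ∞) (fun t => F (Real.cos t)) → ContDiffOn ℝ m F (Icc (-1) 1) := by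
  classical
  have hF0 : ∀ F : ℝ → ℝ, ContDiff ℝ (⊤ : ℕ∞) (fun t => F (Real.cos t)) →
      ContinuousOn F (Icc (-1) 1) := by
    intro F hF
    have : Continuous (fun x => F (Real.cos (Real.arccos x))) :=
      hF.continuous.comp Real.continuous_arccos
    refine this.continuousOn.congr fun x hx => ?_
    simp only
    rw [Real.cos_arccos hx.1 hx.2]
  induction m with
  | zero => 
    intro F hF
    exact contDiffOn_zero.2 (hF0 F hF)
  | succ m ih =>
    intro F hF
    set g : ℝ → ℝ := fun t => F (Real.cos t) with hg
    have hgd : Differentiable ℝ g := hF.differentiable (by simp)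
    have hg' : ContDiff ℝ (⊤ : ℕ∞) (deriv g) := (contDiff_infty_iff_deriv.1 hF).2
    -- symmetries
    have sa : ∀ k : ℤ, (fun x => g (2 * k * Real.pi + x)) = g := fun k => by
      funext x
      simp only [hg]
      rw [← Real.cos_eq_cos_iff.2 ⟨k, Or.inl rfl⟩]
    have sb : ∀ k : ℤ, (fun x => g (2 * k * Real.pi - x)) = g := fun k => by
      funext x
      simp only [hg]
      rw [← Real.cos_eq_cos_iff.2 ⟨k, Or.inr rfl⟩]
    have sa1 : ∀ (k : ℤ), (fun x => deriv g (2 * k * Real.pi + x)) = deriv g := fun k => by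
      funext x
      rw [← deriv_comp_const_add, sa k]
    have sb1 : ∀ (k : ℤ), (fun x => deriv g (2 * k * Real.pi - x)) = fun x => - deriv g x :=
      fun k => by
        funext x
        have := deriv_comp_const_sub (f := g) (2 * k * Real.pi) x
        rw [sb k] at this
        rw [this, neg_neg]
    have sa2 : ∀ (k : ℤ) x, deriv (deriv g) (2 * k * Real.pi + x) = deriv (deriv g) x := by
      intro k x
      rw [← deriv_comp_const_add, sa1 k]
    have sb2 : ∀ (k : ℤ) x, deriv (deriv g) (2 * k * Real.pi - x) = deriv (deriv g) x := by
      intro k x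
      have := deriv_comp_const_sub (f := deriv g) (2 * k * Real.pi) x
      rw [sb1 k, deriv.fun_neg] at this
      linarith
    have sina : ∀ (k : ℤ) x, Real.sin (2 * k * Real.pi + x) = Real.sin x := by
      intro k x
      rw [show 2 * k * Real.pi + x = x + k * (2 * Real.pi) by ring, Real.sin_add_int_mul_two_pi]
    have sinb : ∀ (k : ℤ) x, Real.sin (2 * k * Real.pi - x) = - Real.sin x := by
      intro k x
      rw [show 2 * k * Real.pi - x = -x + k * (2 * Real.pi) by ring, Real.sin_add_int_mul_two_pi,
        Real.sin_neg]
    have hG := smooth_div (deriv g) Real.sin hg' Real.contDiff_sin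
      (fun t ht => by
        obtain ⟨k, hk⟩ := Real.sin_eq_zero_iff.1 ht
        have := congrFun (sb1 k) t
        rw [show 2 * (k : ℝ) * Real.pi - t = t by rw [← hk]; ring] at this
        linarith)
      (fun t ht h => by
        rw [Real.deriv_sin] at h
        have := Real.sin_sq_add_cos_sq t
        rw [ht, h] at this
        norm_num at this)
    set G : ℝ → ℝ := fun t => if Real.sin t = 0 then deriv (deriv g) t / deriv Real.sin t
      else deriv g t / Real.sin t with hGdef
    have hGsym : ∀ x y, Real.cos x = Real.cos y → G x = G y := by
      intro x y hxy
      have hxy' := hxy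
      obtain ⟨k, hk | hk⟩ := Real.cos_eq_cos_iff.1 hxy
      · have h1 := congrFun (sa1 k) x
        simp only [hGdef, Real.deriv_sin]
        rw [hxy, hk, sa2, sina, h1]
      · have h1 := congrFun (sb1 k) x
        simp only [hGdef, Real.deriv_sin]
        rw [hxy, hk, sb2, sinb, h1, neg_div_neg_eq]
        simp
    let F₁ : ℝ → ℝ := fun x => - G (Real.arccos x)
    have hF₁ : ContDiff ℝ (⊤ : ℕ∞) (fun t => F₁ (Real.cos t)) := by
      refine (congrArg (ContDiff ℝ (⊤ : ℕ∞)) (funext fun t => ?_)).mp hG.neg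
      simp only [F₁]
      rw [hGsym (Real.arccos (Real.cos t)) t
        (Real.cos_arccos (Real.neg_one_le_cos t) (Real.cos_le_one t))]
    have hint : ∀ x ∈ Ioo (-1 : ℝ) 1, HasDerivAt F (F₁ x) x := by
      intro x hx
      have h1 := (hgd (Real.arccos x)).hasDerivAt.comp x
        (Real.hasDerivAt_arccos hx.1.ne' hx.2.ne)
      have h2 : HasDerivAt F (deriv g (Real.arccos x) * -(1 / √(1 - x ^ 2))) x := by
        refine h1.congr_of_eventuallyEq ?_
        filter_upwards [Ioo_mem_nhds hx.1 hx.2] with y hy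
        simp only [hg, Function.comp]
        rw [Real.cos_arccos hy.1.le hy.2.le]
      convert h2 using 1
      have h3 : Real.sin (Real.arccos x) ≠ 0 :=
        (Real.sin_pos_of_pos_of_lt_pi (Real.arccos_pos.2 hx.2)
          (by
            rw [← Real.arccos_neg_one]
            exact Real.arccos_lt_arccos le_rfl hx.1 hx.2.le)).ne'
      simp only [F₁, hGdef, h3, if_false]
      rw [Real.sin_arccos]
      ring
    have hFc := hF0 F hF
    have hF₁c := hF0 F₁ hF₁
    have hcl : closure (Ioo (-1 : ℝ) 1) = Icc (-1) 1 := closure_Ioo (by norm_num)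
    have hder : ∀ x ∈ Icc (-1 : ℝ) 1, HasDerivWithinAt F (F₁ x) (Icc (-1) 1) x := by
      intro x hx
      have := hasFDerivWithinAt_closure_of_tendsto_fderiv (f := F) (s := Ioo (-1 : ℝ) 1) (x := x)
        (f' := ContinuousLinearMap.toSpanSingleton ℝ (F₁ x))
        (fun y hy => (hint y hy).differentiableAt.differentiableWithinAt)
        (convex_Ioo _ _) isOpen_Ioo
        (fun y hy => (hFc y (hcl ▸ hy)).mono Ioo_subset_Icc_self) ?_
      · rw [hcl] at this
        exact this
      · have h1 : Tendsto F₁ (𝓝[Ioo (-1) 1] x) (𝓝 (F₁ x)) :=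
          (hF₁c x hx).mono Ioo_subset_Icc_self
        have h2 : Tendsto (fun y => ContinuousLinearMap.toSpanSingleton ℝ (F₁ y))
            (𝓝[Ioo (-1) 1] x) (𝓝 (ContinuousLinearMap.toSpanSingleton ℝ (F₁ x))) :=
          ((ContinuousLinearMap.toSpanSingletonCLE (𝕜 := ℝ) (E := ℝ)).continuous.tendsto _).comp h1
        refine h2.congr' ?_
        filter_upwards [self_mem_nhdsWithin] with y hy
        exact (hint y hy).hasFDerivAt.fderiv.symm
    push_cast
    have hu : UniqueDiffOn ℝ (Icc (-1 : ℝ) 1) := uniqueDiffOn_Icc (by norm_num)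
    rw [contDiffOn_succ_iff_derivWithin hu]
    refine ⟨fun x hx => (hder x hx).differentiableWithinAt, by simp, ?_⟩
    exact (ih F₁ hF₁).congr fun x hx => (hder x hx).derivWithin (hu x hx)

/-- A zonal function `f(u) = f̄(⟨eₙ, u⟩)` on the sphere `S^n ⊂ ℝ^{n+1}` is `C^∞` on the
sphere if and only if `f̄ ∈ C^∞[-1,1]`. -/
theorem stmt_12 (n : ℕ) (hn : 1 ≤ n) (fbar : ℝ → ℝ)
    (e : EuclideanSpace ℝ (Fin (n + 1))) (he : e = EuclideanSpace.single (Fin.last n) 1) :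
    ContMDiff (𝓡 n) 𝓘(ℝ, ℝ) (⊤ : ℕ∞)
        (fun u : Metric.sphere (0 : EuclideanSpace ℝ (Fin (n + 1))) 1 =>
          fbar ⟪e, (u : EuclideanSpace ℝ (Fin (n + 1)))⟫)
      ↔ ContDiffOn ℝ (⊤ : ℕ∞) fbar (Set.Icc (-1) 1) := by
  have hee : ‖e‖ = 1 := by rw [he]; simp
  constructor
  · intro H
    refine contDiffOn_infty.2 fun m => contDiffOn_of_comp_cos m fbar ?_
    let e' : EuclideanSpace ℝ (Fin (n + 1)) := EuclideanSpace.single 0 1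
    have hee' : ‖e'‖ = 1 := by simp [e']
    have h0 : Fin.last n ≠ 0 := by
      intro h
      have := congrArg Fin.val h
      simp at this
      omega
    have horth : ⟪e, e'⟫ = 0 := by
      rw [he]
      simp [e', EuclideanSpace.inner_single_left, h0]
    let γ : ℝ → EuclideanSpace ℝ (Fin (n + 1)) := fun t => Real.cos t • e + Real.sin t • e'
    have hγ : ContDiff ℝ (⊤ : ℕ∞) γ :=
      (Real.contDiff_cos.smul contDiff_const).add (Real.contDiff_sin.smul contDiff_const)
    have hγs : ∀ t, γ t ∈ Metric.sphere (0 : EuclideanSpace ℝ (Fin (n + 1))) 1 := by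
      intro t
      rw [mem_sphere_zero_iff_norm]
      have h1 : ‖γ t‖ ^ 2 = 1 := by
        simp only [γ]
        rw [norm_add_sq_real, norm_smul, norm_smul, hee, hee', inner_smul_left, inner_smul_right,
          horth]
        simp
      have h2 := norm_nonneg (γ t)
      nlinarith
    have h1 := H.comp (ContMDiff.codRestrict_sphere (n := n) hγ.contMDiff hγs)
    refine (congrArg (ContDiff ℝ (⊤ : ℕ∞)) (funext fun t => ?_)).mp
      (contMDiff_iff_contDiff.1 h1)
    simp only [Function.comp, Set.val_codRestrict_apply, γ]
    rw [inner_add_right, inner_smul_right, inner_smul_right, horth, real_inner_self_eq_norm_sq,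
      hee]
    simp
  · intro H
    have h1 : ContMDiff (𝓡 n) 𝓘(ℝ, ℝ) (⊤ : ℕ∞)
        (fun u : Metric.sphere (0 : EuclideanSpace ℝ (Fin (n + 1))) 1 =>
          ⟪e, (u : EuclideanSpace ℝ (Fin (n + 1)))⟫) := by
      have h2 : ContDiff ℝ (⊤ : ℕ∞) (fun u : EuclideanSpace ℝ (Fin (n + 1)) => ⟪e, u⟫) :=
        contDiff_const.inner ℝ contDiff_id
      exact h2.contMDiff.comp contMDiff_coe_sphere
    refine H.contMDiffOn.comp_contMDiff h1 fun u => ?_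
    have h3 := abs_real_inner_le_norm e (u : EuclideanSpace ℝ (Fin (n + 1)))
    have h4 : ‖(u : EuclideanSpace ℝ (Fin (n + 1)))‖ = 1 := mem_sphere_zero_iff_norm.1 u.2
    rw [hee, h4, mul_one] at h3
    exact abs_le.1 h3
end

section
/- Let L ⊂ ℝⁿ be a convex body of revolution with support function h_L(u) = η(⟨eₙ,u⟩), where the one-homogeneous extension of h_L is C² away from the origin. Then its surface area measure has density dS_{n-1}(L,u) = (A₁η)(⟨eₙ,u⟩)^{n-2} (A₂η)(⟨eₙ,u⟩) du with respect to the spherical Lebesgue measure, where (A₁η)(t) = η(t) − tη'(t) and (A₂η)(t) = (1−t²)η''(t) + η(t) − tη'(t). -/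
open RealInnerProductSpace MeasureTheory

section SurfaceAreaAux
open Topology NNReal ENNReal
set_option linter.unusedSectionVars false

variable {E : Type*} [NormedAddCommGroup E] [InnerProductSpace ℝ E]

lemma aux_norm_proj (v p q u w : E) (hv : ‖v‖ = 1) (ε K : ℝ) (hK : 1 < K)
    (hε : ε ^ 2 = 1 - (K ^ 2)⁻¹) (hε0 : 0 ≤ ε)
    (hu : ‖u - v‖ ≤ ε) (hw : ‖w - v‖ ≤ ε) (hup : 0 ≤ ⟪u, p - q⟫) (hwp : ⟪w, p - q⟫ ≤ 0) :
    ‖p - q‖ ≤ K * ‖(ℝ ∙ v)ᗮ.orthogonalProjectionOnto p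
      - (ℝ ∙ v)ᗮ.orthogonalProjectionOnto q‖ := by
  rw [← map_sub]
  generalize p - q = x at *
  have h1 : ⟪u, x⟫ - ⟪v, x⟫ ≤ ε * ‖x‖ := by
    rw [← inner_sub_left]
    exact (real_inner_le_norm _ _).trans (by gcongr)
  have h2 : ⟪v, x⟫ - ⟪w, x⟫ ≤ ε * ‖x‖ := by
    rw [← inner_sub_left]
    refine (real_inner_le_norm _ _).trans ?_
    rw [norm_sub_rev]; gcongr
  have h3 : ⟪v, x⟫ ^ 2 ≤ (ε * ‖x‖) ^ 2 := by
    rw [sq_le_sq, abs_of_nonneg (a := ε * ‖x‖) (by positivity)]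
    rw [abs_le]; constructor <;> linarith
  have h4 := Submodule.norm_sq_eq_add_norm_sq_projection x (ℝ ∙ v)
  have h5 : ‖(ℝ ∙ v).orthogonalProjectionOnto x‖ ^ 2 = ⟪v, x⟫ ^ 2 := by
    have : ((ℝ ∙ v).orthogonalProjectionOnto x : E) = ⟪v, x⟫ • v :=
      Submodule.starProjection_unit_singleton ℝ hv x
    rw [Submodule.coe_norm, this, norm_smul, hv]; simp
  rw [h5] at h4
  rw [← abs_of_nonneg (norm_nonneg x), ← abs_of_nonneg (a := K * _) (by positivity), ← sq_le_sq]
  rw [mul_pow] at h3 ⊢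
  rw [hε] at h3
  have hK2 : 0 < K ^ 2 := by positivity
  have : (K ^ 2)⁻¹ * ‖x‖ ^ 2 ≤ ‖(ℝ ∙ v)ᗮ.orthogonalProjectionOnto x‖ ^ 2 := by nlinarith
  calc ‖x‖ ^ 2 = K ^ 2 * ((K ^ 2)⁻¹ * ‖x‖ ^ 2) := by field_simp
    _ ≤ _ := by gcongr

lemma aux_K (d : ℕ) {a b : ℝ≥0} (hab : a < b) : ∃ K : ℝ≥0, 1 < K ∧ K ^ d * a ≤ b := by
  have h : Filter.Tendsto (fun K : ℝ≥0 => K ^ d * a) (𝓝 1) (𝓝 ((1 : ℝ≥0) ^ d * a)) :=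
    (by fun_prop : Continuous fun K : ℝ≥0 => K ^ d * a).tendsto 1
  rw [one_pow, one_mul] at h
  have h2 := (h.eventually (gt_mem_nhds hab)).filter_mono (nhdsWithin_le_nhds (s := Set.Ioi 1))
  obtain ⟨K, hK1, hK2⟩ := (h2.and self_mem_nhdsWithin).exists
  exact ⟨K, hK2, hK1.le⟩

variable [FiniteDimensional ℝ E] [MeasurableSpace E] [BorelSpace E]

lemma aux_haus_le (v : E) (g : E → E) (ω : Set E) (d : ℕ) (K : ℝ≥0)
    (h : ∀ u ∈ ω, ∀ w ∈ ω, ‖g u - g w‖ ≤ K * ‖(ℝ ∙ v)ᗮ.orthogonalProjectionOnto (g u)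
      - (ℝ ∙ v)ᗮ.orthogonalProjectionOnto (g w)‖) :
    μH[(d : ℝ)] (g '' ω) ≤ (K : ℝ≥0∞) ^ d *
      μH[(d : ℝ)] ((ℝ ∙ v)ᗮ.orthogonalProjectionOnto '' (g '' ω)) := by
  set P := (ℝ ∙ v)ᗮ.orthogonalProjectionOnto with hP
  have hinj : Set.InjOn P (g '' ω) := by
    rintro _ ⟨u, hu, rfl⟩ _ ⟨w, hw, rfl⟩ he
    have := h u hu w hw
    rw [he, sub_self, norm_zero, mul_zero] at this
    exact sub_eq_zero.1 (norm_le_zero_iff.1 this)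
  have hL : LipschitzOnWith K (Function.invFunOn P (g '' ω)) (P '' (g '' ω)) := by
    refine LipschitzOnWith.of_dist_le_mul ?_
    rintro _ ⟨_, ⟨u, hu, rfl⟩, rfl⟩ _ ⟨_, ⟨w, hw, rfl⟩, rfl⟩
    rw [hinj.leftInvOn_invFunOn ⟨u, hu, rfl⟩, hinj.leftInvOn_invFunOn ⟨w, hw, rfl⟩,
      dist_eq_norm, dist_eq_norm]
    exact h u hu w hw
  have := hL.hausdorffMeasure_image_le (d := (d : ℝ)) (by positivity)
  rw [hinj.invFunOn_image subset_rfl, ENNReal.rpow_natCast] at this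
  exact this

lemma aux_haus_proj (v : E) (ω : Set E) (d : ℕ) :
    μH[(d : ℝ)] ((ℝ ∙ v)ᗮ.orthogonalProjectionOnto '' ω) ≤ μH[(d : ℝ)] ω := by
  have := ((ℝ ∙ v)ᗮ.lipschitzWith_orthogonalProjectionOnto.lipschitzOnWith (s := ω)).hausdorffMeasure_image_le
    (d := (d : ℝ)) (by positivity)
  simpa using this

lemma aux_eps {K : ℝ} (hK : 1 < K) : ∃ ε : ℝ, 0 < ε ∧ ε ^ 2 = 1 - (K ^ 2)⁻¹ := by
  have : 0 < 1 - (K ^ 2)⁻¹ := by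
    have : (K ^ 2)⁻¹ < 1 := inv_lt_one_of_one_lt₀ (by nlinarith)
    linarith
  exact ⟨√(1 - (K ^ 2)⁻¹), Real.sqrt_pos.2 this, Real.sq_sqrt this.le⟩

lemma aux_sphere_inner (u w : E) (hu : ‖u‖ = 1) (hw : ‖w‖ = 1) : 0 ≤ ⟪u, u - w⟫ := by
  rw [inner_sub_right, real_inner_self_eq_norm_sq, hu]
  have := real_inner_le_norm u w
  rw [hu, hw] at this; linarith

lemma aux_bilip (f : E → E) (hf : ∀ u w : E, ‖u‖ = 1 → ‖w‖ = 1 → 0 ≤ ⟪u, f u - f w⟫)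
    (v : E) (hv : ‖v‖ = 1) (K : ℝ≥0) (hK : 1 < K) :
    ∃ U ∈ 𝓝 v, ∀ u ∈ U, ∀ w ∈ U, ‖u‖ = 1 → ‖w‖ = 1 →
      ‖f u - f w‖ ≤ K * ‖(ℝ ∙ v)ᗮ.orthogonalProjectionOnto (f u)
      - (ℝ ∙ v)ᗮ.orthogonalProjectionOnto (f w)‖ := by
  obtain ⟨ε, hε, h2⟩ := aux_eps (K := K) (by exact_mod_cast hK)
  refine ⟨Metric.closedBall v ε, Metric.closedBall_mem_nhds _ hε, ?_⟩
  intro u hu w hw hu1 hw1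
  rw [mem_closedBall_iff_norm] at hu hw
  refine aux_norm_proj v _ _ u w hv ε K (by exact_mod_cast hK) h2 hε.le hu hw (hf u w hu1 hw1) ?_
  have := hf w u hw1 hu1
  rw [← neg_sub, inner_neg_right] at this
  linarith

/-- the compression of `f'` to the orthogonal complement of `v` -/
noncomputable def auxA (v : E) (f' : E →L[ℝ] E) : (ℝ ∙ v)ᗮ →L[ℝ] (ℝ ∙ v)ᗮ :=
  ((ℝ ∙ v)ᗮ.orthogonalProjectionOnto ∘L f') ∘L (ℝ ∙ v)ᗮ.subtypeL

lemma aux_local (f : E → E) (hf : ∀ u w : E, ‖u‖ = 1 → ‖w‖ = 1 → 0 ≤ ⟪u, f u - f w⟫)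
    (v : E) (hv : ‖v‖ = 1) (f' : E →L[ℝ] E) (hf' : HasStrictFDerivAt f f' v) (hfv : f' v = 0)
    (d : ℕ) (K δ : ℝ≥0) (hK : 1 < K) (hδ : 0 < δ) :
    ∃ U ∈ 𝓝 v, ∀ ω ⊆ U, (∀ u ∈ ω, ‖u‖ = 1) → 
      ∃ (T : Set (ℝ ∙ v)ᗮ) (g : (ℝ ∙ v)ᗮ → (ℝ ∙ v)ᗮ), ApproximatesLinearOn g (auxA v f') T δ ∧
        μH[(d : ℝ)] T ≤ μH[(d : ℝ)] ω ∧ μH[(d : ℝ)] ω ≤ (K : ℝ≥0∞) ^ d * μH[(d : ℝ)] T ∧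
        μH[(d : ℝ)] (g '' T) ≤ μH[(d : ℝ)] (f '' ω) ∧
        μH[(d : ℝ)] (f '' ω) ≤ (K : ℝ≥0∞) ^ d * μH[(d : ℝ)] (g '' T) := by
  obtain ⟨U1, hU1, h1⟩ := aux_bilip f hf v hv K hK
  obtain ⟨U2, hU2, h2⟩ := aux_bilip id (fun u w => aux_sphere_inner u w) v hv K hK
  obtain ⟨U3, hU3, h3⟩ := hf'.approximates_deriv_on_nhds (c := δ / K) (Or.inr (by positivity))
  refine ⟨U1 ∩ U2 ∩ U3, Filter.inter_mem (Filter.inter_mem hU1 hU2) hU3, ?_⟩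
  intro ω hω hω1
  set P := (ℝ ∙ v)ᗮ.orthogonalProjectionOnto with hP
  have hinj : Set.InjOn P ω := by
    intro u hu w hw he
    have := h2 u (hω hu).1.2 w (hω hw).1.2 (hω1 u hu) (hω1 w hw)
    simp only [id] at this
    rw [he, sub_self, norm_zero, mul_zero] at this
    exact sub_eq_zero.1 (norm_le_zero_iff.1 this)
  have hinv : ∀ u ∈ ω, Function.invFunOn P ω (P u) = u := fun u hu => hinj.leftInvOn_invFunOn hu
  have him : (fun y => P (f (Function.invFunOn P ω y))) '' (P '' ω) = P '' (f '' ω) := by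
    rw [Set.image_image, Set.image_image]
    refine Set.image_congr fun u hu => ?_
    simp only [hinv u hu]
  refine ⟨P '' ω, fun y => P (f (Function.invFunOn P ω y)), ?_, aux_haus_proj v ω d, ?_, ?_, ?_⟩
  · rintro _ ⟨u, hu, rfl⟩ _ ⟨w, hw, rfl⟩
    simp only [hinv u hu, hinv w hw]
    have e1 : auxA v f' (P u - P w) = P (f' (u - w)) := by
      have : ((P (u - w) : (ℝ ∙ v)ᗮ) : E) = (u - w) - ⟪v, u - w⟫ • v := by
        have h := (ℝ ∙ v).starProjection_orthogonal_val (u - w)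
        rw [Submodule.starProjection_unit_singleton ℝ hv] at h
        exact h
      rw [← map_sub]
      simp only [auxA, ContinuousLinearMap.comp_apply, Submodule.subtypeL_apply, this]
      rw [map_sub f', map_smul f', hfv, smul_zero, sub_zero]
    rw [e1, ← map_sub, ← map_sub]
    refine ((ℝ ∙ v)ᗮ.norm_orthogonalProjectionOnto_apply_le _).trans ?_
    refine (h3 u (hω hu).2 w (hω hw).2).trans ?_
    have := h2 u (hω hu).1.2 w (hω hw).1.2 (hω1 u hu) (hω1 w hw)
    simp only [id] at this
    have hK0 : (0 : ℝ) < K := by exact_mod_cast zero_lt_one.trans hK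
    calc ((δ / K : ℝ≥0) : ℝ) * ‖u - w‖ ≤ ((δ / K : ℝ≥0) : ℝ) * (K * ‖P u - P w‖) := by gcongr
      _ = δ * ‖P u - P w‖ := by push_cast; field_simp
  · have := aux_haus_le v id ω d K fun u hu w hw =>
      h2 u (hω hu).1.2 w (hω hw).1.2 (hω1 u hu) (hω1 w hw)
    simpa using this
  · rw [him]; exact aux_haus_proj v _ d
  · rw [him]
    exact aux_haus_le v f ω d K fun u hu w hw =>
      h1 u (hω hu).1.1 w (hω hw).1.1 (hω1 u hu) (hω1 w hw)

lemma aux_haar (d : ℕ) (hd : Module.finrank ℝ E = d + 1) (v : E) (hv : ‖v‖ = 1) :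
    (μH[(d : ℝ)] : Measure (ℝ ∙ v)ᗮ).IsAddHaarMeasure := by
  have : Fact (Module.finrank ℝ E = d + 1) := ⟨hd⟩
  have := isAddHaarMeasure_hausdorffMeasure (E := (ℝ ∙ v)ᗮ)
  rwa [Submodule.finrank_orthogonal_span_singleton (n := d) (by rintro rfl; simp at hv)] at this

lemma aux_upper (f : E → E) (hf : ∀ u w : E, ‖u‖ = 1 → ‖w‖ = 1 → 0 ≤ ⟪u, f u - f w⟫)
    (v : E) (hv : ‖v‖ = 1) (f' : E →L[ℝ] E) (hf' : HasStrictFDerivAt f f' v) (hfv : f' v = 0)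
    (d : ℕ) (hd : Module.finrank ℝ E = d + 1) (m : ℝ≥0) (hm : |(auxA v f').det| < m) :
    ∃ U ∈ 𝓝 v, ∀ ω ⊆ U, (∀ u ∈ ω, ‖u‖ = 1) → 
      μH[(d : ℝ)] (f '' ω) ≤ m * μH[(d : ℝ)] ω := by
  have := aux_haar d hd v hv
  obtain ⟨m', h1, h2⟩ := exists_between ((Real.toNNReal_lt_iff_lt_coe (abs_nonneg _)).2 hm)
  obtain ⟨K, hK, hK2⟩ := aux_K d h2
  have h3 := addHaar_image_le_mul_of_det_lt (μH[(d : ℝ)]) (auxA v f') (m := m')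
    (by rw [ENNReal.ofReal]; exact_mod_cast h1)
  obtain ⟨δ, h4, hδ⟩ := (h3.and self_mem_nhdsWithin).exists
  obtain ⟨U, hU, h⟩ := aux_local f hf v hv f' hf' hfv d K δ hK hδ
  refine ⟨U, hU, fun ω hω hω1 => ?_⟩
  obtain ⟨T, g, ha, i1, i2, i3, i4⟩ := h ω hω hω1
  calc μH[(d : ℝ)] (f '' ω) ≤ (K : ℝ≥0∞) ^ d * μH[(d : ℝ)] (g '' T) := i4
    _ ≤ (K : ℝ≥0∞) ^ d * (m' * μH[(d : ℝ)] T) := by gcongr; exact h4 T g ha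
    _ ≤ (K : ℝ≥0∞) ^ d * (m' * μH[(d : ℝ)] ω) := by gcongr
    _ = ((K ^ d * m' : ℝ≥0) : ℝ≥0∞) * μH[(d : ℝ)] ω := by push_cast; ring
    _ ≤ _ := by gcongr

lemma aux_lower (f : E → E) (hf : ∀ u w : E, ‖u‖ = 1 → ‖w‖ = 1 → 0 ≤ ⟪u, f u - f w⟫)
    (v : E) (hv : ‖v‖ = 1) (f' : E →L[ℝ] E) (hf' : HasStrictFDerivAt f f' v) (hfv : f' v = 0)
    (d : ℕ) (hd : Module.finrank ℝ E = d + 1) (m : ℝ≥0) (hm : m < |(auxA v f').det|) :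
    ∃ U ∈ 𝓝 v, ∀ ω ⊆ U, (∀ u ∈ ω, ‖u‖ = 1) → 
      m * μH[(d : ℝ)] ω ≤ μH[(d : ℝ)] (f '' ω) := by
  have := aux_haar d hd v hv
  obtain ⟨m', h1, h2⟩ := exists_between ((Real.lt_toNNReal_iff_coe_lt).2 hm)
  obtain ⟨K, hK, hK2⟩ := aux_K d h1
  have h3 := mul_le_addHaar_image_of_lt_det (μH[(d : ℝ)]) (auxA v f') (m := m')
    (by rw [ENNReal.ofReal]; exact_mod_cast h2)
  obtain ⟨δ, h4, hδ⟩ := (h3.and self_mem_nhdsWithin).exists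
  obtain ⟨U, hU, h⟩ := aux_local f hf v hv f' hf' hfv d K δ hK hδ
  refine ⟨U, hU, fun ω hω hω1 => ?_⟩
  obtain ⟨T, g, ha, i1, i2, i3, i4⟩ := h ω hω hω1
  calc m * μH[(d : ℝ)] ω ≤ m * ((K : ℝ≥0∞) ^ d * μH[(d : ℝ)] T) := by gcongr
    _ = ((K ^ d * m : ℝ≥0) : ℝ≥0∞) * μH[(d : ℝ)] T := by push_cast; ring
    _ ≤ m' * μH[(d : ℝ)] T := by gcongr
    _ ≤ _ := h4 T g ha
    _ ≤ _ := i3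

lemma aux_finite (d : ℕ) (hd : Module.finrank ℝ E = d + 1) :
    μH[(d : ℝ)] (Metric.sphere (0 : E) 1) < ⊤ := by
  refine (isCompact_sphere (0 : E) 1).measure_lt_top_of_nhdsWithin fun v hv => ?_
  rw [mem_sphere_zero_iff_norm] at hv
  have := aux_haar d hd v hv
  obtain ⟨U, hU, h⟩ := aux_bilip id (fun u w => aux_sphere_inner u w) v hv 2 (by norm_num)
  refine ⟨U ∩ Metric.sphere 0 1, Filter.inter_mem (mem_nhdsWithin_of_mem_nhds hU)
    self_mem_nhdsWithin, ?_⟩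
  have h2 := aux_haus_le v id (U ∩ Metric.sphere 0 1) d 2 fun u hu w hw =>
    h u hu.1 w hw.1 (by simpa using hu.2) (by simpa using hw.2)
  rw [Set.image_id] at h2
  refine h2.trans_lt (ENNReal.mul_lt_top (by simp) ?_)
  have hc : IsCompact ((ℝ ∙ v)ᗮ.orthogonalProjectionOnto '' (Metric.sphere (0 : E) 1)) :=
    (isCompact_sphere (0 : E) 1).image (by fun_prop)
  refine (measure_mono ?_).trans_lt hc.measure_lt_top
  exact Set.image_mono Set.inter_subset_right

lemma aux_global_le (f : E → E) (D : E → ℝ) (d : ℕ)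
    (hup : ∀ v : E, ‖v‖ = 1 → ∀ m : ℝ≥0, D v < m → ∃ U ∈ 𝓝 v, ∀ ω ⊆ U, (∀ u ∈ ω, ‖u‖ = 1) →
      μH[(d : ℝ)] (f '' ω) ≤ m * μH[(d : ℝ)] ω)
    (hD : ContinuousOn D (Metric.sphere 0 1)) (hD0 : ∀ v : E, ‖v‖ = 1 → 0 ≤ D v)
    (ε : ℝ≥0) (hε : 0 < ε) (ω : Set E) (hω : MeasurableSet ω) (hωS : ω ⊆ Metric.sphere 0 1) :
    μH[(d : ℝ)] (f '' ω) ≤ ∫⁻ u in ω, (ENNReal.ofReal (D u) + ε) ∂μH[(d : ℝ)] := by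
  obtain ⟨T, hT, hST, h⟩ : ∃ T : Set E, MeasurableSet T ∧ Metric.sphere 0 1 ⊆ T ∧ 
      ∀ ω ⊆ T, MeasurableSet ω → ω ⊆ Metric.sphere 0 1 → 
      μH[(d : ℝ)] (f '' ω) ≤ ∫⁻ u in ω, (ENNReal.ofReal (D u) + ε) ∂μH[(d : ℝ)] := by
    refine IsCompact.induction_on (p := fun S => ∃ T : Set E, MeasurableSet T ∧ S ⊆ T ∧ 
      ∀ ω ⊆ T, MeasurableSet ω → ω ⊆ Metric.sphere 0 1 → 
      μH[(d : ℝ)] (f '' ω) ≤ ∫⁻ u in ω, (ENNReal.ofReal (D u) + ε) ∂μH[(d : ℝ)])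
      (isCompact_sphere (0 : E) 1) ?_ ?_ ?_ ?_
    · refine ⟨∅, MeasurableSet.empty, subset_rfl, fun ω hω _ _ => ?_⟩
      rw [Set.subset_empty_iff.1 hω]; simp
    · rintro s t hst ⟨T, h1, h2, h3⟩
      exact ⟨T, h1, hst.trans h2, h3⟩
    · rintro s t ⟨T, h1, h2, h3⟩ ⟨T', h1', h2', h3'⟩
      refine ⟨T ∪ T', h1.union h1', Set.union_subset_union h2 h2', fun ω hω hm hωs => ?_⟩
      rw [← lintegral_inter_add_sdiff _ ω h1]
      calc μH[(d : ℝ)] (f '' ω) = μH[(d : ℝ)] (f '' (ω ∩ T) ∪ f '' (ω \ T)) := by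
            rw [← Set.image_union, Set.inter_union_sdiff]
        _ ≤ _ := measure_union_le _ _
        _ ≤ _ := by
          gcongr
          · exact h3 _ Set.inter_subset_right (hm.inter h1) (Set.inter_subset_left.trans hωs)
          · refine h3' _ ?_ (hm.diff h1) (Set.sdiff_subset.trans hωs)
            rintro x ⟨hx, hx'⟩
            exact (hω hx).resolve_left hx'
    · intro v hv
      have hv1 : ‖v‖ = 1 := by simpa using hv
      obtain ⟨U, hU, h⟩ := hup v hv1 ((D v).toNNReal + ε / 2) (by
        push_cast; rw [Real.coe_toNNReal _ (hD0 v hv1)]; simpa using hε)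
      have hc : ∀ᶠ u in 𝓝[Metric.sphere 0 1] v, D v - ε / 2 < D u :=
        (hD v hv).eventually (lt_mem_nhds (by simpa using hε))
      rw [eventually_nhdsWithin_iff] at hc
      obtain ⟨V, hV, hVo, hvV⟩ := mem_nhds_iff.1 (Filter.inter_mem hU hc)
      refine ⟨V, mem_nhdsWithin_of_mem_nhds (hVo.mem_nhds hvV), V, hVo.measurableSet, subset_rfl,
        fun ω hω hm hωs => ?_⟩
      refine (h ω (fun x hx => (hV (hω hx)).1) fun u hu => by simpa using hωs hu).trans ?_
      rw [← setLIntegral_const]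
      refine setLIntegral_mono' hm fun u hu => ?_
      have h1 := (hV (hω hu)).2 (hωs hu)
      rw [ENNReal.ofReal, ← ENNReal.coe_add, ENNReal.coe_le_coe, ← NNReal.coe_le_coe]
      push_cast
      rw [Real.coe_toNNReal _ (hD0 v hv1), Real.coe_toNNReal _ (hD0 u (by simpa using hωs hu))]
      linarith
  exact h ω (hωS.trans hST) hω hωS

lemma aux_global_ge (f : E → E) (D : E → ℝ) (d : ℕ)
    (hlow : ∀ v : E, ‖v‖ = 1 → ∀ m : ℝ≥0, m < D v → ∃ U ∈ 𝓝 v, ∀ ω ⊆ U, (∀ u ∈ ω, ‖u‖ = 1) →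
      m * μH[(d : ℝ)] ω ≤ μH[(d : ℝ)] (f '' ω))
    (hD : ContinuousOn D (Metric.sphere 0 1)) (hD0 : ∀ v : E, ‖v‖ = 1 → 0 ≤ D v)
    (hfc : ContinuousOn f (Metric.sphere 0 1)) 
    (ε : ℝ≥0) (hε : 0 < ε) (ω : Set E) (hω : MeasurableSet ω) (hωS : ω ⊆ Metric.sphere 0 1) 
    (hinj : Set.InjOn f ω) :
    ∫⁻ u in ω, ENNReal.ofReal (D u) ∂μH[(d : ℝ)] ≤ μH[(d : ℝ)] (f '' ω) + ε * μH[(d : ℝ)] ω := by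
  obtain ⟨T, hT, hST, h⟩ : ∃ T : Set E, MeasurableSet T ∧ Metric.sphere 0 1 ⊆ T ∧ 
      ∀ ω ⊆ T, MeasurableSet ω → ω ⊆ Metric.sphere 0 1 → Set.InjOn f ω →
      ∫⁻ u in ω, ENNReal.ofReal (D u) ∂μH[(d : ℝ)]
        ≤ μH[(d : ℝ)] (f '' ω) + ε * μH[(d : ℝ)] ω := by
    refine IsCompact.induction_on (p := fun S => ∃ T : Set E, MeasurableSet T ∧ S ⊆ T ∧ 
      ∀ ω ⊆ T, MeasurableSet ω → ω ⊆ Metric.sphere 0 1 → Set.InjOn f ω →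
      ∫⁻ u in ω, ENNReal.ofReal (D u) ∂μH[(d : ℝ)]
        ≤ μH[(d : ℝ)] (f '' ω) + ε * μH[(d : ℝ)] ω)
      (isCompact_sphere (0 : E) 1) ?_ ?_ ?_ ?_
    · refine ⟨∅, MeasurableSet.empty, subset_rfl, fun ω hω _ _ _ => ?_⟩
      rw [Set.subset_empty_iff.1 hω]; simp
    · rintro s t hst ⟨T, h1, h2, h3⟩
      exact ⟨T, h1, hst.trans h2, h3⟩
    · rintro s t ⟨T, h1, h2, h3⟩ ⟨T', h1', h2', h3'⟩
      refine ⟨T ∪ T', h1.union h1', Set.union_subset_union h2 h2', fun ω hω hm hωs hi => ?_⟩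
      rw [← lintegral_inter_add_sdiff _ ω h1]
      have e1 : μH[(d : ℝ)] (f '' ω)
          = μH[(d : ℝ)] (f '' (ω ∩ T)) + μH[(d : ℝ)] (f '' (ω \ T)) := by
        conv_lhs => rw [← Set.inter_union_sdiff ω T, Set.image_union]
        refine measure_union ?_ ?_
        · rw [Set.disjoint_left]
          rintro _ ⟨x, hx, rfl⟩ ⟨y, hy, hxy⟩
          have := hi hy.1 hx.1 hxy
          exact hy.2 (this ▸ hx.2)
        · exact (hm.diff h1).image_of_continuousOn_injOn
            (hfc.mono (Set.sdiff_subset.trans hωs)) (hi.mono Set.sdiff_subset)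
      rw [e1, ← measure_inter_add_sdiff ω h1]
      refine (add_le_add (h3 _ Set.inter_subset_right (hm.inter h1) 
        (Set.inter_subset_left.trans hωs) (hi.mono Set.inter_subset_left))
        (h3' _ ?_ (hm.diff h1) (Set.sdiff_subset.trans hωs) (hi.mono Set.sdiff_subset))).trans ?_
      · rintro x ⟨hx, hx'⟩
        exact (hω hx).resolve_left hx'
      · apply le_of_eq; ring
    · intro v hv
      have hv1 : ‖v‖ = 1 := by simpa using hv
      obtain ⟨U, hU, h⟩ : ∃ U ∈ 𝓝 v, ∀ ω ⊆ U, (∀ u ∈ ω, ‖u‖ = 1) →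
          (((D v).toNNReal - ε / 2 : ℝ≥0) : ℝ≥0∞) * μH[(d : ℝ)] ω ≤ μH[(d : ℝ)] (f '' ω) := by
        rcases (hD0 v hv1).eq_or_lt with h0 | h0
        · refine ⟨Set.univ, Filter.univ_mem, fun ω _ _ => ?_⟩
          rw [← h0]; simp
        · refine hlow v hv1 _ ?_
          rw [← Real.lt_toNNReal_iff_coe_lt]
          exact tsub_lt_self (Real.toNNReal_pos.2 h0) (by positivity)
      have hc : ∀ᶠ u in 𝓝[Metric.sphere 0 1] v, D u < D v + ε / 2 :=
        (hD v hv).eventually (gt_mem_nhds (by simpa using hε))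
      rw [eventually_nhdsWithin_iff] at hc
      obtain ⟨V, hV, hVo, hvV⟩ := mem_nhds_iff.1 (Filter.inter_mem hU hc)
      refine ⟨V, mem_nhdsWithin_of_mem_nhds (hVo.mem_nhds hvV), V, hVo.measurableSet, subset_rfl,
        fun ω hω hm hωs _ => ?_⟩
      have hh := h ω (fun x hx => (hV (hω hx)).1) fun u hu => by simpa using hωs hu
      refine le_trans ?_ (add_le_add_left hh _)
      rw [← add_mul, ← setLIntegral_const]
      refine setLIntegral_mono' hm fun u hu => ?_
      have h1 := (hV (hω hu)).2 (hωs hu)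
      rw [ENNReal.ofReal, ← ENNReal.coe_add, ENNReal.coe_le_coe, ← NNReal.coe_le_coe]
      rw [Real.coe_toNNReal _ (hD0 u (by simpa using hωs hu))]
      have h2 : ((D v).toNNReal : ℝ) ≤ (((D v).toNNReal - ε / 2 + ε / 2 : ℝ≥0) : ℝ) := by
        exact_mod_cast le_tsub_add
      rw [Real.coe_toNNReal _ (hD0 v hv1)] at h2
      push_cast at h2 ⊢
      linarith
  exact h ω (hωS.trans hST) hω hωS hinj

lemma aux_global (f : E → E) (D : E → ℝ) (d : ℕ) (hd : Module.finrank ℝ E = d + 1)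
    (hf : ∀ u w : E, ‖u‖ = 1 → ‖w‖ = 1 → 0 ≤ ⟪u, f u - f w⟫)
    (hD : ContinuousOn D (Metric.sphere 0 1)) (hD0 : ∀ v : E, ‖v‖ = 1 → 0 ≤ D v)
    (hfd : ∀ v : E, ‖v‖ = 1 → ∃ f' : E →L[ℝ] E, HasStrictFDerivAt f f' v ∧ f' v = 0 ∧
      (auxA v f').det = D v)
    (hinj : ∀ u w : E, ‖u‖ = 1 → ‖w‖ = 1 → D u ≠ 0 → f u = f w → u = w)
    (ω : Set E) (hω : MeasurableSet ω) (hωS : ω ⊆ Metric.sphere 0 1) :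
    (μH[(d : ℝ)] (f '' ω)).toReal = ∫ u in ω, D u ∂μH[(d : ℝ)] := by
  have hfc : ContinuousOn f (Metric.sphere 0 1) := fun v hv => by
    obtain ⟨f', h, -⟩ := hfd v (by simpa using hv)
    exact h.continuousAt.continuousWithinAt
  have hfin : ∀ s ⊆ Metric.sphere (0 : E) 1, μH[(d : ℝ)] s ≠ ⊤ := fun s hs =>
    ((measure_mono hs).trans_lt (aux_finite d hd)).ne
  have key : μH[(d : ℝ)] (f '' ω) = ∫⁻ u in ω, ENNReal.ofReal (D u) ∂μH[(d : ℝ)] := by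
    apply le_antisymm
    · have h1 : ∀ ε : ℝ≥0, 0 < ε → μH[(d : ℝ)] (f '' ω) ≤ 
          ∫⁻ u in ω, ENNReal.ofReal (D u) ∂μH[(d : ℝ)] + ε * μH[(d : ℝ)] ω := by
        intro ε hε
        have := aux_global_le f D d (fun v hv m hm => by
          obtain ⟨f', h1, h2, h3⟩ := hfd v hv
          refine aux_upper f hf v hv f' h1 h2 d hd m ?_
          rwa [h3, abs_of_nonneg (hD0 v hv)]) hD hD0 ε hε ω hω hωS
        rwa [lintegral_add_right _ measurable_const, setLIntegral_const] at this
      have h2 : Filter.Tendsto (fun ε : ℝ≥0 =>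
          ∫⁻ u in ω, ENNReal.ofReal (D u) ∂μH[(d : ℝ)] + ε * μH[(d : ℝ)] ω) (𝓝[>] 0)
          (𝓝 (∫⁻ u in ω, ENNReal.ofReal (D u) ∂μH[(d : ℝ)] + ((0 : ℝ≥0) : ℝ≥0∞) * μH[(d : ℝ)] ω)) := by
        refine Filter.Tendsto.mono_left ?_ nhdsWithin_le_nhds
        refine tendsto_const_nhds.add (ENNReal.Tendsto.mul_const ?_ (Or.inr (hfin ω hωS)))
        exact ENNReal.tendsto_coe.2 Filter.tendsto_id
      simp only [ENNReal.coe_zero, zero_mul, add_zero] at h2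
      exact ge_of_tendsto h2 (Filter.eventually_of_mem self_mem_nhdsWithin fun ε hε => h1 ε hε)
    · have hmD : MeasurableSet (ω ∩ {u | D u = 0}) := by
        have : ω ∩ {u | D u = 0} = ω ∩ (Metric.sphere 0 1 ∩ D ⁻¹' {0}) := by
          ext x; constructor
          · rintro ⟨a, b⟩; exact ⟨a, hωS a, b⟩
          · rintro ⟨a, _, b⟩; exact ⟨a, b⟩
        rw [this]
        exact hω.inter (hD.preimage_isClosed_of_isClosed Metric.isClosed_sphere
          isClosed_singleton).measurableSet
      set ω' := ω \ (ω ∩ {u | D u = 0}) with hω'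
      have hω'm : MeasurableSet ω' := hω.diff hmD
      have hω's : ω' ⊆ ω := Set.sdiff_subset
      have e0 : ∫⁻ u in ω, ENNReal.ofReal (D u) ∂μH[(d : ℝ)]
          = ∫⁻ u in ω', ENNReal.ofReal (D u) ∂μH[(d : ℝ)] := by
        rw [← lintegral_inter_add_sdiff _ ω hmD, ← hω']
        rw [setLIntegral_congr_fun (g := fun _ => 0) (hω.inter hmD) (fun u hu => by
          simp [show D u = 0 from hu.2.2])]
        simp
      rw [e0]
      refine le_trans ?_ (measure_mono (Set.image_mono hω's))
      have h1 : ∀ ε : ℝ≥0, 0 < ε → ∫⁻ u in ω', ENNReal.ofReal (D u) ∂μH[(d : ℝ)] ≤ 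
          μH[(d : ℝ)] (f '' ω') + ε * μH[(d : ℝ)] ω' := by
        intro ε hε
        refine aux_global_ge f D d (fun v hv m hm => by
          obtain ⟨f', h1, h2, h3⟩ := hfd v hv
          refine aux_lower f hf v hv f' h1 h2 d hd m ?_
          rwa [h3, abs_of_nonneg (hD0 v hv)]) hD hD0 hfc ε hε ω' hω'm (hω's.trans hωS) ?_
        intro u hu w hw he
        exact hinj u w (by simpa using hωS hu.1) (by simpa using hωS hw.1)
          (fun h0 => hu.2 ⟨hu.1, h0⟩) he
      have h2 : Filter.Tendsto (fun ε : ℝ≥0 =>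
          μH[(d : ℝ)] (f '' ω') + ε * μH[(d : ℝ)] ω') (𝓝[>] 0)
          (𝓝 (μH[(d : ℝ)] (f '' ω') + ((0 : ℝ≥0) : ℝ≥0∞) * μH[(d : ℝ)] ω')) := by
        refine Filter.Tendsto.mono_left ?_ nhdsWithin_le_nhds
        refine tendsto_const_nhds.add (ENNReal.Tendsto.mul_const ?_
          (Or.inr (hfin ω' (hω's.trans hωS))))
        exact ENNReal.tendsto_coe.2 Filter.tendsto_id
      simp only [ENNReal.coe_zero, zero_mul, add_zero] at h2
      exact ge_of_tendsto h2 (Filter.eventually_of_mem self_mem_nhdsWithin fun ε hε => h1 ε hε)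
  rw [key, integral_eq_lintegral_of_nonneg_ae]
  · exact (ae_restrict_iff' hω).2 (Filter.Eventually.of_forall fun u hu =>
      hD0 u (by simpa using hωS hu))
  · exact (hD.mono hωS).aestronglyMeasurable hω

lemma aux_det {W : Type*} [NormedAddCommGroup W] [InnerProductSpace ℝ W] [FiniteDimensional ℝ W]
    (d : ℕ) (hd : Module.finrank ℝ W = d + 1) (A : W →L[ℝ] W) (a : W) (c b : ℝ)
    (hA : ∀ w, A w = c • w + (b * ⟪a, w⟫) • a) : A.det = c ^ d * (c + b * ‖a‖ ^ 2) := by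
  set B : W →L[ℝ] W := (b • innerSL ℝ a).smulRight a with hB
  have hAB : A = c • ContinuousLinearMap.id ℝ W + B := by
    ext w; simp [hA, hB]
  rw [hAB]
  have h := Continuous.ext_on (f := fun c : ℝ => (c • ContinuousLinearMap.id ℝ W + B).det)
    (g := fun c => c ^ d * (c + b * ‖a‖ ^ 2)) (dense_compl_singleton (0 : ℝ))
    (ContinuousLinearMap.continuous_det.comp (by fun_prop)) (by fun_prop) ?_
  · exact congrFun h c
  · intro c hc
    have hc : c ≠ 0 := hc
    have e1 : ((c • ContinuousLinearMap.id ℝ W + B : W →L[ℝ] W) : W →ₗ[ℝ] W)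
        = c • LinearMap.transvection ((c⁻¹ * b) • (innerSL ℝ a : W →ₗ[ℝ] ℝ)) a := by
      ext w
      simp [hB, LinearMap.transvection.apply, smul_smul]
      congr 1; field_simp
    simp only [ContinuousLinearMap.det]
    rw [e1, LinearMap.det_smul, LinearMap.transvection.det, hd]
    simp
    field_simp
    ring

lemma aux_det_nonneg {W : Type*} [NormedAddCommGroup W] [InnerProductSpace ℝ W]
    [FiniteDimensional ℝ W]
    (d : ℕ) (hd : Module.finrank ℝ W = d + 1) (a : W) (c b : ℝ)
    (hA : ∀ w : W, 0 ≤ c * ‖w‖ ^ 2 + b * ⟪a, w⟫ ^ 2) : 0 ≤ c ^ d * (c + b * ‖a‖ ^ 2) := by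
  have h1 : 0 ≤ c + b * ‖a‖ ^ 2 := by
    by_cases ha : a = 0
    · have : Nontrivial W := Module.nontrivial_of_finrank_pos (R := ℝ) (by omega)
      obtain ⟨w, hw⟩ := exists_ne (0 : W)
      have h := hA w
      simp only [ha, inner_zero_left, norm_zero] at h ⊢
      have : 0 < ‖w‖ ^ 2 := by positivity
      have : 0 ≤ c := by
        by_contra hc
        push Not at hc
        nlinarith
      simpa using this
    · have h := hA a
      rw [real_inner_self_eq_norm_sq] at h
      have h0 : 0 < ‖a‖ ^ 2 := by positivity
      by_contra hc
      push Not at hc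
      nlinarith
  rcases Nat.eq_zero_or_pos d with rfl | hd0
  · simpa using h1
  · have h2 : 0 ≤ c := by
      have h3 := (ℝ ∙ a).finrank_add_finrank_orthogonal
      have h4 : Module.finrank ℝ (ℝ ∙ a) ≤ 1 := by
        simpa using finrank_span_le_card (R := ℝ) ({a} : Set W)
      have : Nontrivial (ℝ ∙ a)ᗮ := Module.nontrivial_of_finrank_pos (R := ℝ) (by omega)
      obtain ⟨w, hw⟩ := exists_ne (0 : (ℝ ∙ a)ᗮ)
      have h := hA w
      rw [Submodule.mem_orthogonal_singleton_iff_inner_right.1 w.2] at h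
      have : 0 < ‖(w : W)‖ ^ 2 := by
        have : (w : W) ≠ 0 := by simpa using hw
        positivity
      by_contra hc
      push Not at hc
      nlinarith
    positivity

/-- The closed interval on which `η` lives. -/
abbrev auxI : Set ℝ := Set.Icc (-1) 1

/-- The reverse Gauss map, as a `0`-homogeneous map. -/
noncomputable def auxF (e : E) (η : ℝ → ℝ) (x : E) : E :=
  derivWithin η (Set.Icc (-1) 1) (‖x‖⁻¹ * ⟪e, x⟫) • e +
    (η (‖x‖⁻¹ * ⟪e, x⟫) - (‖x‖⁻¹ * ⟪e, x⟫) * derivWithin η (Set.Icc (-1) 1) (‖x‖⁻¹ * ⟪e, x⟫)) •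
      (‖x‖⁻¹ • x)

lemma auxF_smul (e : E) (η : ℝ → ℝ) (x : E) (c : ℝ) (hc : 0 < c) :
    auxF e η (c • x) = auxF e η x := by
  have h1 : ‖c • x‖⁻¹ * ⟪e, c • x⟫ = ‖x‖⁻¹ * ⟪e, x⟫ := by
    rw [norm_smul, inner_smul_right, Real.norm_of_nonneg hc.le, mul_inv]; field_simp
  have h2 : ‖c • x‖⁻¹ • c • x = ‖x‖⁻¹ • x := by
    rw [norm_smul, Real.norm_of_nonneg hc.le, smul_smul, mul_inv]
    congr 1; field_simp
  rw [auxF, h1, h2, auxF]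

lemma aux_s_mem (e : E) (he : ‖e‖ = 1) (x : E) : ‖x‖⁻¹ * ⟪e, x⟫ ∈ Set.Icc (-1 : ℝ) 1 := by
  have h := abs_real_inner_le_norm e x
  rw [he, one_mul] at h
  rw [Set.mem_Icc, ← abs_le, abs_mul, abs_of_nonneg (inv_nonneg.2 (norm_nonneg x))]
  rcases eq_or_ne x 0 with rfl | hx
  · simp
  · rw [inv_mul_le_iff₀ (norm_pos_iff.2 hx)]; simpa using h

lemma aux_uniq : UniqueDiffOn ℝ (Set.Icc (-1 : ℝ) 1) := uniqueDiffOn_Icc (by norm_num)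

lemma auxF_contDiffAt (e : E) (he : ‖e‖ = 1) (η : ℝ → ℝ)
    (hη : ContDiffOn ℝ 2 η (Set.Icc (-1) 1)) (v : E) (hv : v ≠ 0) :
    ContDiffAt ℝ 1 (auxF e η) v := by
  have hopen : IsOpen {x : E | x ≠ 0} := isOpen_ne
  have hη1 : ContDiffOn ℝ 1 (derivWithin η (Set.Icc (-1) 1)) (Set.Icc (-1) 1) :=
    hη.derivWithin aux_uniq (by norm_num)
  have hr : ContDiffOn ℝ 1 (fun x : E => ‖x‖⁻¹) {x : E | x ≠ 0} := fun x hx =>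
    ((contDiffAt_norm ℝ hx).inv (norm_ne_zero_iff.2 hx)).contDiffWithinAt
  have hs : ContDiffOn ℝ 1 (fun x : E => ‖x‖⁻¹ * ⟪e, x⟫) {x : E | x ≠ 0} :=
    hr.mul (contDiff_const.inner ℝ contDiff_id).contDiffOn
  have hm : Set.MapsTo (fun x : E => ‖x‖⁻¹ * ⟪e, x⟫) {x : E | x ≠ 0} (Set.Icc (-1) 1) :=
    fun x _ => aux_s_mem e he x
  have h1 := hη1.comp hs hm
  have h0 := (hη.of_le (by norm_num : (1 : WithTop ℕ∞) ≤ 2)).comp hs hm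
  have : ContDiffOn ℝ 1 (auxF e η) {x : E | x ≠ 0} :=
    (h1.smul contDiffOn_const).add ((h0.sub (hs.mul h1)).smul (hr.smul contDiffOn_id))
  exact this.contDiffAt (hopen.mem_nhds hv)

lemma aux_r_deriv (v : E) (hv : ‖v‖ = 1) :
    HasFDerivAt (fun x : E => ‖x‖⁻¹) (-innerSL ℝ v) v ∧
    HasFDerivAt (fun x : E => ‖x‖) (innerSL ℝ v) v := by
  have hv0 : v ≠ 0 := by rintro rfl; simp at hv
  have h1 : HasFDerivAt (fun x : E => ‖x‖) (innerSL ℝ v) v := by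
    have h2 := (hasStrictFDerivAt_norm_sq v).hasFDerivAt.sqrt (by rw [hv]; norm_num)
    simp only [Real.sqrt_sq (norm_nonneg _), hv] at h2
    convert h2 using 1
    ext w; simp
  refine ⟨?_, h1⟩
  have := (hasDerivAt_inv (x := ‖v‖) (by rw [hv]; norm_num)).comp_hasFDerivAt v h1
  refine HasFDerivAt.congr_fderiv (f := fun x : E => ‖x‖⁻¹) this ?_
  simp [hv]

lemma aux_s_deriv (e v : E) (hv : ‖v‖ = 1) :
    HasFDerivAt (fun x : E => ‖x‖⁻¹ * ⟪e, x⟫) (innerSL ℝ e - ⟪e, v⟫ • innerSL ℝ v) v := by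
  have h := (aux_r_deriv v hv).1.mul (innerSL ℝ e).hasFDerivAt
  simp only [innerSL_apply_apply] at h
  refine HasFDerivAt.congr_fderiv (f := fun x : E => ‖x‖⁻¹ * ⟪e, x⟫) h ?_
  ext w; simp [hv]; ring

lemma aux_h_deriv (e : E) (he : ‖e‖ = 1) (η : ℝ → ℝ)
    (hη : ContDiffOn ℝ 2 η (Set.Icc (-1) 1)) (v : E) (hv : ‖v‖ = 1) :
    HasFDerivAt (fun x : E => ‖x‖ * η (‖x‖⁻¹ * ⟪e, x⟫)) (innerSL ℝ (auxF e η v)) v := by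
  have hd : HasDerivWithinAt η (derivWithin η (Set.Icc (-1) 1) (‖v‖⁻¹ * ⟪e, v⟫))
      (Set.Icc (-1) 1) (‖v‖⁻¹ * ⟪e, v⟫) :=
    ((hη.differentiableOn (by norm_num)) _ (aux_s_mem e he v)).hasDerivWithinAt
  have h1 := hd.comp_hasFDerivAt v (aux_s_deriv e v hv)
    (Filter.Eventually.of_forall fun x => aux_s_mem e he x)
  have h2 := (aux_r_deriv v hv).2.mul h1
  refine HasFDerivAt.congr_fderiv (f := fun x : E => ‖x‖ * η (‖x‖⁻¹ * ⟪e, x⟫)) h2 ?_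
  ext w
  simp [auxF, hv, inner_add_left, inner_smul_left]
  ring

lemma auxF_deriv (e : E) (he : ‖e‖ = 1) (η : ℝ → ℝ)
    (hη : ContDiffOn ℝ 2 η (Set.Icc (-1) 1)) (v : E) (hv : ‖v‖ = 1) :
    ∃ f' : E →L[ℝ] E, HasStrictFDerivAt (auxF e η) f' v ∧ ∀ w, f' w =
      (η ⟪e, v⟫ - ⟪e, v⟫ * derivWithin η (Set.Icc (-1) 1) ⟪e, v⟫) • (w - ⟪v, w⟫ • v) +
      (derivWithin (derivWithin η (Set.Icc (-1) 1)) (Set.Icc (-1) 1) ⟪e, v⟫ *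
        (⟪e, w⟫ - ⟪e, v⟫ * ⟪v, w⟫)) • (e - ⟪e, v⟫ • v) := by
  have hv0 : v ≠ 0 := by rintro rfl; simp at hv
  have hstr := (auxF_contDiffAt e he η hη v hv0).hasStrictFDerivAt (by norm_num)
  refine ⟨_, hstr, fun w => ?_⟩
  have hη1 : ContDiffOn ℝ 1 (derivWithin η (Set.Icc (-1) 1)) (Set.Icc (-1) 1) :=
    hη.derivWithin aux_uniq (by norm_num)
  have hs := aux_s_deriv e v hv
  have hev := Filter.Eventually.of_forall (f := 𝓝 v) fun x => aux_s_mem e he x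
  have hd : HasDerivWithinAt η (derivWithin η (Set.Icc (-1) 1) (‖v‖⁻¹ * ⟪e, v⟫))
      (Set.Icc (-1) 1) (‖v‖⁻¹ * ⟪e, v⟫) :=
    ((hη.differentiableOn (by norm_num)) _ (aux_s_mem e he v)).hasDerivWithinAt
  have hd1 : HasDerivWithinAt (derivWithin η (Set.Icc (-1) 1))
      (derivWithin (derivWithin η (Set.Icc (-1) 1)) (Set.Icc (-1) 1) (‖v‖⁻¹ * ⟪e, v⟫))
      (Set.Icc (-1) 1) (‖v‖⁻¹ * ⟪e, v⟫) :=
    ((hη1.differentiableOn (by norm_num)) _ (aux_s_mem e he v)).hasDerivWithinAt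
  have h0 := hd.comp_hasFDerivAt v hs hev
  have h1 := hd1.comp_hasFDerivAt v hs hev
  have h2 : HasFDerivAt (auxF e η) _ v := (h1.smul_const e).add
    ((h0.sub (hs.mul h1)).smul ((aux_r_deriv v hv).1.smul (hasFDerivAt_id v)))
  rw [h2.fderiv]
  simp [hv]
  module

lemma aux_auxA (e : E) (he : ‖e‖ = 1) (v : E) (hv : ‖v‖ = 1) (f' : E →L[ℝ] E) (c b : ℝ)
    (hf' : ∀ w, f' w = c • (w - ⟪v, w⟫ • v) +
      (b * (⟪e, w⟫ - ⟪e, v⟫ * ⟪v, w⟫)) • (e - ⟪e, v⟫ • v)) :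
    (∀ w, auxA v f' w = c • w + (b * ⟪(ℝ ∙ v)ᗮ.orthogonalProjectionOnto e, w⟫) •
      (ℝ ∙ v)ᗮ.orthogonalProjectionOnto e) ∧
    ‖(ℝ ∙ v)ᗮ.orthogonalProjectionOnto e‖ ^ 2 = 1 - ⟪e, v⟫ ^ 2 := by
  constructor
  · intro w
    have h0 : ⟪v, (w : E)⟫ = 0 := Submodule.mem_orthogonal_singleton_iff_inner_right.1 w.2
    have h1 : ⟪(ℝ ∙ v)ᗮ.orthogonalProjectionOnto e, w⟫ = ⟪e, (w : E)⟫ := by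
      simp
    simp only [auxA, ContinuousLinearMap.comp_apply, Submodule.subtypeL_apply, hf', h0, h1,
      map_add, map_smul, map_sub]
    have h2 : (ℝ ∙ v)ᗮ.orthogonalProjectionOnto v = 0 :=
      Submodule.orthogonalProjectionOnto_orthogonalComplement_singleton_eq_zero v
    rw [h2, Submodule.orthogonalProjectionOnto_mem_subspace_eq_self]
    simp
  · have h4 := Submodule.norm_sq_eq_add_norm_sq_projection e (ℝ ∙ v)
    have h5 : ‖(ℝ ∙ v).orthogonalProjectionOnto e‖ ^ 2 = ⟪e, v⟫ ^ 2 := by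
      have : ((ℝ ∙ v).orthogonalProjectionOnto e : E) = ⟪v, e⟫ • v :=
        Submodule.starProjection_unit_singleton ℝ hv e
      rw [Submodule.coe_norm, this, norm_smul, hv, real_inner_comm]; simp
    rw [h5, he] at h4
    linarith

lemma aux_face (e : E) (he : ‖e‖ = 1) (L : Set E) (hLcomp : IsCompact L) (hLne : L.Nonempty)
    (η : ℝ → ℝ) (hη : ContDiffOn ℝ 2 η (Set.Icc (-1) 1))
    (hsupp : ∀ u : E, ‖u‖ = 1 → sSup ((fun x => ⟪u, x⟫) '' L) = η ⟪e, u⟫)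
    (z : E) (hz : z ≠ 0) (x : E) :
    (x ∈ L ∧ ∀ y ∈ L, ⟪z, y⟫ ≤ ⟪z, x⟫) ↔ x = auxF e η z := by
  have hbdd : ∀ u : E, BddAbove ((fun x => ⟪u, x⟫) '' L) := fun u =>
    (hLcomp.image (by fun_prop)).bddAbove
  -- the support function inequality
  have hle : ∀ y ∈ L, ∀ z : E, z ≠ 0 → ⟪z, y⟫ ≤ ‖z‖ * η (‖z‖⁻¹ * ⟪e, z⟫) := by
    intro y hy z hz
    have hn : ‖z‖ ≠ 0 := norm_ne_zero_iff.2 hz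
    have h1 := hsupp (‖z‖⁻¹ • z) (by rw [norm_smul, norm_inv, norm_norm, inv_mul_cancel₀ hn])
    have h2 := le_csSup (hbdd (‖z‖⁻¹ • z)) ⟨y, hy, rfl⟩
    rw [h1, inner_smul_right] at h2
    simp only [inner_smul_left, conj_trivial] at h2
    rwa [inv_mul_le_iff₀ (norm_pos_iff.2 hz)] at h2
  have key : ∀ u : E, ‖u‖ = 1 → ∀ x ∈ L, (∀ y ∈ L, ⟪u, y⟫ ≤ ⟪u, x⟫) → x = auxF e η u := by
    intro u hu x hx hmax
    have hu0 : u ≠ 0 := by rintro rfl; simp at hu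
    have heq : ⟪u, x⟫ = η ⟪e, u⟫ := by
      rw [← hsupp u hu]
      symm
      refine IsGreatest.csSup_eq (s := (fun x => ⟪u, x⟫) '' L) (a := ⟪u, x⟫) ⟨⟨x, hx, rfl⟩, ?_⟩
      rintro _ ⟨y, hy, rfl⟩
      exact hmax y hy
    have hd := (aux_h_deriv e he η hη u hu).sub (innerSL ℝ x).hasFDerivAt
    have hmin : IsLocalMin ((fun x : E => ‖x‖ * η (‖x‖⁻¹ * ⟪e, x⟫)) - ⇑(innerSL ℝ x)) u := by
      filter_upwards [isOpen_ne.mem_nhds hu0] with z hz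
      have := hle x hx z hz
      simp only [Pi.sub_apply, innerSL_apply_apply, hu, inv_one, one_mul]
      linarith [real_inner_comm x z, real_inner_comm x u]
    have h0 := hmin.hasFDerivAt_eq_zero hd
    rw [sub_eq_zero] at h0
    have h1 : ∀ w, ⟪auxF e η u, w⟫ = ⟪x, w⟫ := fun w => by
      have := congrArg (fun T : E →L[ℝ] ℝ => T w) h0
      simpa using this
    exact (ext_inner_right ℝ h1).symm
  have hn : 0 < ‖z‖⁻¹ := inv_pos.2 (norm_pos_iff.2 hz)
  have hu : ‖(‖z‖⁻¹ • z)‖ = 1 := by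
    rw [norm_smul, norm_inv, norm_norm, inv_mul_cancel₀ (norm_ne_zero_iff.2 hz)]
  have key2 : ∀ x ∈ L, (∀ y ∈ L, ⟪z, y⟫ ≤ ⟪z, x⟫) → x = auxF e η z := by
    intro x hx h
    rw [← auxF_smul e η z _ hn]
    refine key _ hu x hx fun y hy => ?_
    simp only [inner_smul_left, conj_trivial]
    exact mul_le_mul_of_nonneg_left (h y hy) hn.le
  constructor
  · rintro ⟨hx, h⟩
    exact key2 x hx h
  · rintro rfl
    obtain ⟨x, hx, hm⟩ := hLcomp.exists_isMaxOn hLne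
      (f := fun y => ⟪z, y⟫) (by fun_prop)
    have := key2 x hx (fun y hy => hm hy)
    rw [← this]
    exact ⟨hx, fun y hy => hm hy⟩

theorem aux_main_s18 (k : ℕ) (hk : Module.finrank ℝ E = k + 2) (e : E) (he : ‖e‖ = 1) (L : Set E)
    (hLcomp : IsCompact L) (hLne : L.Nonempty)
    (η : ℝ → ℝ) (hη : ContDiffOn ℝ 2 η (Set.Icc (-1) 1))
    (hsupp : ∀ u : E, ‖u‖ = 1 → sSup ((fun x => ⟪u, x⟫) '' L) = η ⟪e, u⟫)
    (ω : Set E) (hω : MeasurableSet ω) (hωS : ω ⊆ Metric.sphere (0 : E) 1) :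
    (μH[((k + 1 : ℕ) : ℝ)] {x : E | x ∈ frontier L ∧ ∃ v ∈ ω, ∀ y ∈ L, ⟪v, y⟫ ≤ ⟪v, x⟫}).toReal
      = ∫ u in ω, (η ⟪e, u⟫ - ⟪e, u⟫ * derivWithin η (Set.Icc (-1) 1) ⟪e, u⟫) ^ k *
              ((1 - ⟪e, u⟫ ^ 2) *
                  derivWithin (derivWithin η (Set.Icc (-1) 1)) (Set.Icc (-1) 1) ⟪e, u⟫
                + η ⟪e, u⟫ - ⟪e, u⟫ * derivWithin η (Set.Icc (-1) 1) ⟪e, u⟫)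
            ∂(μH[((k + 1 : ℕ) : ℝ)]) := by
  have hface := aux_face e he L hLcomp hLne η hη hsupp
  have hne : ∀ v : E, ‖v‖ = 1 → v ≠ 0 := by rintro v hv rfl; simp at hv
  have hset : {x : E | x ∈ frontier L ∧ ∃ v ∈ ω, ∀ y ∈ L, ⟪v, y⟫ ≤ ⟪v, x⟫} = auxF e η '' ω := by
    ext x; constructor
    · rintro ⟨hx, v, hv, h⟩
      exact ⟨v, hv, ((hface v (hne v (by simpa using hωS hv)) x).1
        ⟨hLcomp.isClosed.frontier_subset hx, h⟩).symm⟩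
    · rintro ⟨v, hv, rfl⟩
      have hv1 : ‖v‖ = 1 := by simpa using hωS hv
      obtain ⟨h1, h2⟩ := (hface v (hne v hv1) _).2 rfl
      refine ⟨⟨subset_closure h1, fun hi => ?_⟩, v, hv, h2⟩
      have hc : Filter.Tendsto (fun τ : ℝ => auxF e η v + τ • v) (𝓝[>] 0) (𝓝 (auxF e η v)) := by
        have : Continuous (fun τ : ℝ => auxF e η v + τ • v) := by fun_prop
        have h := this.tendsto 0
        simp only [zero_smul, add_zero] at h
        exact h.mono_left nhdsWithin_le_nhds
      obtain ⟨τ, hτ, hτ0⟩ := ((hc.eventually (mem_interior_iff_mem_nhds.1 hi)).and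
        self_mem_nhdsWithin).exists
      have h3 := h2 _ hτ
      rw [inner_add_right, inner_smul_right, real_inner_self_eq_norm_sq, hv1] at h3
      have : (0 : ℝ) < τ := hτ0
      linarith
  rw [hset]
  have hmono : ∀ u w : E, u ≠ 0 → w ≠ 0 → 0 ≤ ⟪u, auxF e η u - auxF e η w⟫ := by
    intro u w hu hw
    rw [inner_sub_right]
    linarith [((hface u hu _).2 rfl).2 _ ((hface w hw _).2 rfl).1]
  have hη1 : ContDiffOn ℝ 1 (derivWithin η (Set.Icc (-1) 1)) (Set.Icc (-1) 1) :=
    hη.derivWithin aux_uniq (by norm_num)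
  have hη2 : ContDiffOn ℝ 0 (derivWithin (derivWithin η (Set.Icc (-1) 1)) (Set.Icc (-1) 1))
      (Set.Icc (-1) 1) := hη1.derivWithin aux_uniq (by norm_num)
  have hfr : ∀ v : E, ‖v‖ = 1 → Module.finrank ℝ (ℝ ∙ v)ᗮ = k + 1 := fun v hv => by
    have : Fact (Module.finrank ℝ E = (k + 1) + 1) := ⟨hk⟩
    exact Submodule.finrank_orthogonal_span_singleton (hne v hv)
  have hdet : ∀ v : E, ‖v‖ = 1 → ∃ f' : E →L[ℝ] E, HasStrictFDerivAt (auxF e η) f' v ∧ f' v = 0 ∧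
      (auxA v f').det = (η ⟪e, v⟫ - ⟪e, v⟫ * derivWithin η (Set.Icc (-1) 1) ⟪e, v⟫) ^ k *
              ((1 - ⟪e, v⟫ ^ 2) *
                  derivWithin (derivWithin η (Set.Icc (-1) 1)) (Set.Icc (-1) 1) ⟪e, v⟫
                + η ⟪e, v⟫ - ⟪e, v⟫ * derivWithin η (Set.Icc (-1) 1) ⟪e, v⟫) ∧
      0 ≤ (auxA v f').det := by
    intro v hv
    obtain ⟨f', h1, h2⟩ := auxF_deriv e he η hη v hv
    obtain ⟨h3, h4⟩ := aux_auxA e he v hv f' _ _ h2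
    have h5 := aux_det k (hfr v hv) _ _ _ _ h3
    refine ⟨f', h1, ?_, ?_, ?_⟩
    · rw [h2, real_inner_self_eq_norm_sq, hv]; simp
    · rw [h5, h4]; ring
    · rw [h5]
      refine aux_det_nonneg k (hfr v hv) _ _ _ fun w => ?_
      have h0 : ⟪v, (w : E)⟫ = 0 := Submodule.mem_orthogonal_singleton_iff_inner_right.1 w.2
      have e1 : ⟪(w : E), f' w⟫ = ⟪w, auxA v f' w⟫ := by simp [auxA]
      have e2 : 0 ≤ ⟪(w : E), f' w⟫ := by
        have hl : HasDerivAt (fun τ : ℝ => v + τ • (w : E)) (w : E) 0 := by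
          simpa using ((hasDerivAt_id (0 : ℝ)).smul_const (w : E)).const_add v
        have h1' : HasFDerivAt (auxF e η) f' (v + (0 : ℝ) • (w : E)) := by
          simpa using h1.hasFDerivAt
        have hc := h1'.comp_hasDerivAt (0 : ℝ) hl
        have hi : HasDerivAt (fun τ : ℝ => ⟪(w : E), auxF e η (v + τ • (w : E))⟫)
            ⟪(w : E), f' w⟫ 0 := ((innerSL ℝ (w : E)).hasFDerivAt).comp_hasDerivAt (0 : ℝ) hc
        have hs := (hasDerivAt_iff_tendsto_slope.1 hi).mono_left
          (nhdsWithin_mono (0 : ℝ) (s := Set.Ioi 0) (fun x (hx : 0 < x) => hx.ne'))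
        refine ge_of_tendsto hs (Filter.eventually_of_mem self_mem_nhdsWithin fun τ hτ => ?_)
        have hτ : (0 : ℝ) < τ := hτ
        have hz : v + τ • (w : E) ≠ 0 := by
          intro h
          have := congrArg (fun x => ⟪v, x⟫) h
          simp [inner_add_right, inner_smul_right, h0, hv] at this
        have m1 := hmono _ _ hz (hne v hv)
        have m2 := hmono _ _ (hne v hv) hz
        rw [inner_add_left, inner_smul_left, conj_trivial] at m1
        rw [inner_sub_right] at m1 m2
        rw [inner_sub_right] at m1
        simp only [slope_def_field, sub_zero, zero_smul, add_zero]
        apply div_nonneg _ hτ.le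
        by_contra hcon
        push Not at hcon
        nlinarith
      rw [e1, h3, inner_add_right, inner_smul_right, inner_smul_right,
        real_inner_self_eq_norm_sq, real_inner_comm _ w] at e2
      linarith
  refine aux_global (auxF e η) _ (k + 1) hk (fun u w hu hw => hmono u w (hne u hu) (hne w hw))
    ?_ ?_ ?_ ?_ ω hω hωS
  · have hi : ContinuousOn (fun u : E => ⟪e, u⟫) (Metric.sphere 0 1) := by fun_prop
    have hm : Set.MapsTo (fun u : E => ⟪e, u⟫) (Metric.sphere 0 1) (Set.Icc (-1) 1) := by
      intro u hu
      have := aux_s_mem e he u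
      rwa [show ‖u‖ = 1 by simpa using hu, inv_one, one_mul] at this
    have c0 := hη.continuousOn.comp hi hm
    have c1 := hη1.continuousOn.comp hi hm
    have c2 := hη2.continuousOn.comp hi hm
    exact ((c0.sub (hi.mul c1)).pow k).mul
      ((((continuousOn_const.sub (hi.pow 2)).mul c2).add c0).sub (hi.mul c1))
  · intro v hv
    obtain ⟨f', h1, h2, h3, h4⟩ := hdet v hv
    rw [h3] at h4; exact h4
  · intro v hv
    obtain ⟨f', h1, h2, h3, h4⟩ := hdet v hv
    exact ⟨f', h1, h2, h3⟩
  · intro u w hu hw hD heq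
    obtain ⟨f', h1, h2, h3, h4⟩ := hdet u hu
    rw [← h3] at hD
    have hinjA : ∀ x, auxA u f' x = 0 → x = 0 := by
      intro x hx
      by_contra hx0
      apply hD
      have : LinearMap.ker (auxA u f' : (ℝ ∙ u)ᗮ →ₗ[ℝ] (ℝ ∙ u)ᗮ) ≠ ⊥ := by
        intro h
        have : x ∈ LinearMap.ker (auxA u f' : (ℝ ∙ u)ᗮ →ₗ[ℝ] (ℝ ∙ u)ᗮ) := hx
        rw [h] at this
        exact hx0 (by simpa using this)
      exact LinearMap.det_eq_zero_iff_ker_ne_bot.2 this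
    have hW : Nontrivial (ℝ ∙ u)ᗮ := Module.nontrivial_of_finrank_pos (R := ℝ) (by rw [hfr u hu]; omega)
    have hopp : w ≠ -u := by
      rintro rfl
      have hall : ∀ y ∈ L, y = auxF e η u := by
        intro y hy
        refine (hface u (hne u hu) y).1 ⟨hy, fun y' hy' => ?_⟩
        have a1 := ((hface u (hne u hu) _).2 rfl).2 y' hy'
        have a2 := ((hface (-u) (hne _ hw) _).2 rfl).2 y hy
        rw [← heq, inner_neg_left, inner_neg_left] at a2
        linarith
      have hconst : auxF e η =ᶠ[𝓝 u] fun _ => auxF e η u := by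
        filter_upwards [isOpen_ne.mem_nhds (hne u hu)] with z hz
        exact hall _ ((hface z hz _).2 rfl).1
      have h0 : f' = 0 := (h1.hasFDerivAt).unique
        ((hasFDerivAt_const _ _).congr_of_eventuallyEq hconst)
      obtain ⟨x, hx⟩ := exists_ne (0 : (ℝ ∙ u)ᗮ)
      exact hx (hinjA x (by simp [auxA, h0]))
    have hl : HasDerivAt (fun τ : ℝ => u + τ • (w - u)) (w - u) 0 := by
      simpa using ((hasDerivAt_id (0 : ℝ)).smul_const (w - u)).const_add u
    have h1' : HasFDerivAt (auxF e η) f' (u + (0 : ℝ) • (w - u)) := by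
      simpa using h1.hasFDerivAt
    have hc := (h1'.comp_hasDerivAt (0 : ℝ) hl).hasDerivWithinAt (s := Set.Icc 0 1)
    have hcst : ∀ τ ∈ Set.Icc (0 : ℝ) 1, u + τ • (w - u) ≠ 0 →
        auxF e η (u + τ • (w - u)) = auxF e η u := by
      intro τ hτ hz
      symm
      refine (hface _ hz _).1 ⟨((hface u (hne u hu) _).2 rfl).1, fun y hy => ?_⟩
      have a1 := ((hface u (hne u hu) _).2 rfl).2 y hy
      have a2 := ((hface w (hne w hw) _).2 rfl).2 y hy
      rw [← heq] at a2
      have : ∀ y, ⟪u + τ • (w - u), y⟫ = (1 - τ) * ⟪u, y⟫ + τ * ⟪w, y⟫ := by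
        intro y
        simp only [inner_add_left, inner_smul_left, inner_sub_left, conj_trivial]; ring
      rw [this, this]
      have := hτ.1
      have : 0 ≤ 1 - τ := by linarith [hτ.2]
      gcongr
    have hconst : (auxF e η ∘ fun τ : ℝ => u + τ • (w - u)) =ᶠ[𝓝[Set.Icc 0 1] 0]
        fun _ => auxF e η u := by
      have hz : ∀ᶠ τ in 𝓝 (0 : ℝ), u + τ • (w - u) ≠ 0 :=
        hl.continuousAt.eventually_ne (by simpa using hne u hu)
      filter_upwards [self_mem_nhdsWithin, mem_nhdsWithin_of_mem_nhds hz] with τ hτ hτz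
      exact hcst τ hτ hτz
    have hzero : f' (w - u) = 0 := by
      have hu1 : UniqueDiffWithinAt ℝ (Set.Icc (0 : ℝ) 1) 0 :=
        uniqueDiffOn_Icc (by norm_num) 0 (by norm_num)
      exact hu1.eq_deriv _ hc ((hasDerivWithinAt_const _ _ _).congr_of_eventuallyEq hconst
        (by simp))
    set P := (ℝ ∙ u)ᗮ.orthogonalProjectionOnto with hP
    have hPv : ((P (w - u) : (ℝ ∙ u)ᗮ) : E) = (w - u) - ⟪u, w - u⟫ • u := by
      have h := (ℝ ∙ u).starProjection_orthogonal_val (w - u)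
      rw [Submodule.starProjection_unit_singleton ℝ hu] at h
      exact h
    have hP0 : P (w - u) = 0 := by
      apply hinjA
      simp only [auxA, ContinuousLinearMap.comp_apply, Submodule.subtypeL_apply, hPv]
      rw [map_sub f', map_smul f', h2, hzero]; simp
    rw [hP0] at hPv
    have hw' : w = ⟪u, w⟫ • u := by
      rw [inner_sub_right, real_inner_self_eq_norm_sq, hu] at hPv
      have h9 : w - ⟪u, w⟫ • u = 0 := by
        have : w - ⟪u, w⟫ • u = (w - u) - (⟪u, w⟫ - 1 ^ 2) • u := by module
        rw [this, ← hPv]; rfl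
      exact sub_eq_zero.1 h9
    have hn : |⟪u, w⟫| = 1 := by
      have := congrArg norm hw'
      rw [norm_smul, hu, hw, mul_one] at this
      exact this.symm
    rcases (_root_.abs_eq zero_le_one).1 hn with h | h
    · rw [h] at hw'; simpa using hw'.symm
    · rw [h] at hw'; exact absurd (by simpa using hw') hopp

end SurfaceAreaAux

/-- Let `L ⊂ ℝⁿ` be a convex body of revolution with support function
`h_L(u) = η(⟨eₙ,u⟩)` on the unit sphere, whose one-homogeneous extension is `C²` away from
the origin. Then its surface area measure (the `(n-1)`-Hausdorff measure of the reverse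
spherical image) has density `(A₁η)^{n-2}(A₂η)` (evaluated at `⟨eₙ,u⟩`) with respect to the
spherical Lebesgue (= Hausdorff) measure, where `(A₁η)(t) = η(t) - tη'(t)` and
`(A₂η)(t) = (1-t²)η''(t) + η(t) - tη'(t)`. -/
theorem stmt_18 (n : ℕ) (hn : 2 ≤ n)
    (e : EuclideanSpace ℝ (Fin n)) (he : e = EuclideanSpace.single ⟨n - 1, by omega⟩ 1)
    (L : Set (EuclideanSpace ℝ (Fin n))) (hLconv : Convex ℝ L) (hLcomp : IsCompact L)
    (hLne : L.Nonempty)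
    (η : ℝ → ℝ) (hη : ContDiffOn ℝ 2 η (Set.Icc (-1) 1))
    (hsupp : ∀ u : EuclideanSpace ℝ (Fin n), ‖u‖ = 1 →
      sSup ((fun x => ⟪u, x⟫) '' L) = η ⟪e, u⟫)
    (hC2 : ContDiffOn ℝ 2 (fun x => sSup ((fun y => ⟪x, y⟫) '' L))
      {x : EuclideanSpace ℝ (Fin n) | x ≠ 0}) :
    ∀ ω : Set (EuclideanSpace ℝ (Fin n)), MeasurableSet ω →
      ω ⊆ Metric.sphere (0 : EuclideanSpace ℝ (Fin n)) 1 →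
      (μH[(n : ℝ) - 1] {x : EuclideanSpace ℝ (Fin n) | x ∈ frontier L ∧
          ∃ v ∈ ω, ∀ y ∈ L, ⟪v, y⟫ ≤ ⟪v, x⟫}).toReal
        = ∫ u in ω,
            (η ⟪e, u⟫ - ⟪e, u⟫ * derivWithin η (Set.Icc (-1) 1) ⟪e, u⟫) ^ (n - 2) *
              ((1 - ⟪e, u⟫ ^ 2) *
                  derivWithin (derivWithin η (Set.Icc (-1) 1)) (Set.Icc (-1) 1) ⟪e, u⟫
                + η ⟪e, u⟫ - ⟪e, u⟫ * derivWithin η (Set.Icc (-1) 1) ⟪e, u⟫)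
            ∂(μH[(n : ℝ) - 1]) := by
  intro ω hω hωS
  obtain ⟨k, rfl⟩ : ∃ k, n = k + 2 := ⟨n - 2, by omega⟩
  have he1 : ‖e‖ = 1 := by rw [he]; simp
  have hd : (((k + 2 : ℕ) : ℝ) - 1) = ((k + 1 : ℕ) : ℝ) := by push_cast; ring
  rw [hd]
  exact aux_main_s18 k (by simp) e he1 L hLcomp hLne η hη hsupp ω hω hωS
end
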